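/- arXiv:math/0509313 — 2 statements merged into one kernel-verified Lean document; each statement's English description precedes it below -/
import Mathlib

section
/- Let M = M^0(S; F(I), G(Lambda); P) be a finitely generated Rees matrix semigroup with zero over a semigroupoid S. If S is prefix-automatic, and the set of non-identity arrows of S is weakly right-ideal-generated by a row cross-section of P, then M is a prefix-automatic semigroup. -/
/- Common framework: graphs, path languages, synchronous regularity,
   semigroupoids, automatic structures, and Rees matrix constructions. -/

namespace AutoRees

/-- Raw data of a semigroupoid: source and target maps on arrows together with a
totalised multiplication (whose values are only meaningful on composable pairs). -/
structure PreSgpd (O A : Type) where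
  src : A → O
  tgt : A → O
  mul : A → A → A

/-- A semigroupoid: the multiplication respects sources and targets and is
associative, on composable pairs. -/
structure Sgpd (O A : Type) extends PreSgpd O A where
  src_mul : ∀ e f, tgt e = src f → src (mul e f) = src e
  tgt_mul : ∀ e f, tgt e = src f → tgt (mul e f) = tgt f
  mul_assoc' : ∀ e f g, tgt e = src f → tgt f = src g →
    mul (mul e f) g = mul e (mul f g)

/-- Evaluate a nonempty word of edge labels as a product in the semigroupoid
(`none` on the empty word). -/
def evalPath? {O A E : Type} (S : PreSgpd O A) (lab : E → A) : List E → Option A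
  | [] => none
  | e :: l => some ((l.map lab).foldl S.mul (lab e))

/-- The consecutive-compatibility condition making a list of edges a path. -/
def IsPathChain {V E : Type} (esrc etgt : E → V) (l : List E) : Prop :=
  List.Chain' (fun e f => etgt e = esrc f) l

/-- The target of a non-empty path. -/
def pathTgt? {V E : Type} (etgt : E → V) (l : List E) : Option V :=
  l.getLast?.map etgt

/-- The source of a non-empty path. -/
def pathSrc? {V E : Type} (esrc : E → V) (l : List E) : Option V :=
  l.head?.map esrc

/-- A set of words is regular if it is a regular language in the usual sense. -/
def IsRegularSet {α : Type} (L : Set (List α)) : Prop :=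
  Language.IsRegular (show Language α from L)

/-- The padding symbol used to pad a pair of paths, at the target of `l`
(the letters of the padded alphabet `X^$` are `Sum.inl` (a genuine edge) or
`Sum.inr (some v)` (the padding edge at vertex `v`)). -/
def padSym {V E : Type} (etgt : E → V) (l : List E) : E ⊕ Option V :=
  Sum.inr (l.getLast?.map etgt)

/-- The padded convolution `(a, b) δ_X` of a pair of paths. -/
def deltaPair {V E : Type} (etgt : E → V) (a b : List E) :
    List ((E ⊕ Option V) × (E ⊕ Option V)) :=
  (a.map Sum.inl).zip (b.map Sum.inl) ++
    (if a.length ≤ b.length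
      then (b.drop a.length).map (fun e => (padSym etgt a, Sum.inl e))
      else (a.drop b.length).map (fun e => (Sum.inl e, padSym etgt b)))

/-- A binary relation on paths is synchronously regular if its image under the
padding map is a regular language over the padded product alphabet. -/
def SyncRegular {V E : Type} (etgt : E → V) (R : Set (List E × List E)) : Prop :=
  IsRegularSet { w | ∃ p ∈ R, w = deltaPair etgt p.1 p.2 }

/-- A choice of representatives `(X, K, ρ)` for a semigroupoid `S`: a graph `X`
with vertex set `S^0` (edge set `E`, source `esrc`, target `etgt`), a semigroupoid
morphism `ρ : X^+ → S` (induced by the edge-labelling `lab`), and a language `K`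
of non-empty paths with `K ρ = S^1`. -/
structure ChoiceOfReps {O A : Type} (S : PreSgpd O A) (E : Type) where
  esrc : E → O
  etgt : E → O
  lab : E → A
  lab_src : ∀ e, S.src (lab e) = esrc e
  lab_tgt : ∀ e, S.tgt (lab e) = etgt e
  K : Set (List E)
  K_path : ∀ l ∈ K, l ≠ [] ∧ IsPathChain esrc etgt l
  K_onto : ∀ a : A, ∃ l ∈ K, evalPath? S lab l = some a

variable {O A E : Type} {S : PreSgpd O A}

/-- The relation `K_=` = {(u,v) ∈ K × K : u ρ = v ρ}. -/
def relEq (C : ChoiceOfReps S E) : Set (List E × List E) :=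
  { p | p.1 ∈ C.K ∧ p.2 ∈ C.K ∧ evalPath? S C.lab p.1 = evalPath? S C.lab p.2 }

/-- The relation `K_a` for an edge `a` of `X`. -/
def relEdge (C : ChoiceOfReps S E) (a : E) : Set (List E × List E) :=
  { p | p.1 ∈ C.K ∧ p.2 ∈ C.K ∧ pathTgt? C.etgt p.1 = some (C.esrc a) ∧
        evalPath? S C.lab (p.1 ++ [a]) = evalPath? S C.lab p.2 }

/-- The relation `K_a` for a vertex `a` of `X` (regarded as the empty path at `a`). -/
def relVertex (C : ChoiceOfReps S E) (v : O) : Set (List E × List E) :=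
  { p | p.1 ∈ C.K ∧ p.2 ∈ C.K ∧ pathTgt? C.etgt p.1 = some v ∧
        evalPath? S C.lab p.1 = evalPath? S C.lab p.2 }

/-- An automatic structure: a finitely generated choice of representatives with
`K` regular such that `K_a` is synchronously regular for every edge and vertex. -/
def IsAutomaticStructure (C : ChoiceOfReps S E) : Prop :=
  Finite E ∧ IsRegularSet C.K ∧
    (∀ a : E, SyncRegular C.etgt (relEdge C a)) ∧
    (∀ v : O, SyncRegular C.etgt (relVertex C v))

/-- The set of non-empty prefixes of words in `K`. -/
def prefs {E : Type} (K : Set (List E)) : Set (List E) :=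
  { p | p ≠ [] ∧ ∃ l ∈ K, p <+: l }

/-- The relation `K'_=` = {(u,v) ∈ K × Pref(K) : u ρ = v ρ}. -/
def relPrefEq (C : ChoiceOfReps S E) : Set (List E × List E) :=
  { p | p.1 ∈ C.K ∧ p.2 ∈ prefs C.K ∧ evalPath? S C.lab p.1 = evalPath? S C.lab p.2 }

/-- A prefix-automatic structure. -/
def IsPrefixAutomaticStructure (C : ChoiceOfReps S E) : Prop :=
  IsAutomaticStructure C ∧ SyncRegular C.etgt (relPrefEq C)

/-- A cross-section: `ρ` restricted to `K` is injective. -/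
def IsCrossSection (C : ChoiceOfReps S E) : Prop :=
  ∀ u ∈ C.K, ∀ v ∈ C.K, evalPath? S C.lab u = evalPath? S C.lab v → u = v

/-- `K` is closed under taking non-empty prefixes. -/
def IsPrefixClosed (C : ChoiceOfReps S E) : Prop :=
  ∀ l ∈ C.K, ∀ p : List E, p ≠ [] → p <+: l → p ∈ C.K

/-- A semigroupoid (or semigroup, in the one-object case) is automatic if it
admits an automatic structure. -/
def IsAutomatic (S : PreSgpd O A) : Prop :=
  ∃ (E : Type) (C : ChoiceOfReps S E), IsAutomaticStructure C

/-- Prefix-automaticity. -/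
def IsPrefixAutomatic (S : PreSgpd O A) : Prop :=
  ∃ (E : Type) (C : ChoiceOfReps S E), IsPrefixAutomaticStructure C

/-- Finite generation: every arrow is a (composable) product of arrows from some
fixed finite set. -/
def IsFG (S : PreSgpd O A) : Prop :=
  ∃ T : Set A, T.Finite ∧ ∀ a : A, ∃ l : List A, l ≠ [] ∧ (∀ x ∈ l, x ∈ T) ∧
    IsPathChain S.src S.tgt l ∧ evalPath? S id l = some a

/-- An arrow is an identity if it acts as an identity on all composable products. -/
def IsIdentity (S : PreSgpd O A) (e : A) : Prop :=
  (∀ x, S.tgt e = S.src x → S.mul e x = x) ∧ (∀ y, S.tgt y = S.src e → S.mul y e = y)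

/-- A small category is a semigroupoid with an identity arrow at every object. -/
def IsSmallCategory (S : PreSgpd O A) : Prop :=
  ∀ v : O, ∃ e : A, S.src e = v ∧ S.tgt e = v ∧ IsIdentity S e

/-- No object is isolated. -/
def IsolationFree (S : PreSgpd O A) : Prop :=
  ∀ v : O, ∃ a : A, S.src a = v ∨ S.tgt a = v

namespace Rees

variable {O A I Λ : Type}

/-- A triple `(i, x, λ)` is valid if `i F = x α` and `x ω = λ G`. -/
def Valid (S : Sgpd O A) (F : I → O) (G : Λ → O) (t : I × A × Λ) : Prop :=
  F t.1 = S.src t.2.1 ∧ S.tgt t.2.1 = G t.2.2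

/-- The set of valid Rees triples. -/
def Triples (S : Sgpd O A) (F : I → O) (G : Λ → O) : Type :=
  { t : I × A × Λ // Valid S F G t }

theorem prod_valid (S : Sgpd O A) {F : I → O} {G : Λ → O}
    {i : I} {x : A} {lam : Λ} {j : I} {y : A} {mu : Λ} {p : A}
    (hx : Valid S F G (i, x, lam)) (hy : Valid S F G (j, y, mu))
    (hps : S.src p = G lam) (hpt : S.tgt p = F j) :
    Valid S F G (i, S.mul (S.mul x p) y, mu) := by
  obtain ⟨hx1, hx2⟩ := hx
  obtain ⟨hy1, hy2⟩ := hy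
  have h1 : S.tgt x = S.src p := by rw [hps]; exact hx2
  have h2 : S.tgt p = S.src y := by rw [hpt]; exact hy1
  have h3 : S.tgt (S.mul x p) = S.src y := by rw [S.tgt_mul x p h1]; exact h2
  constructor
  · show F i = S.src (S.mul (S.mul x p) y)
    rw [S.src_mul _ y h3, S.src_mul x p h1]; exact hx1
  · show S.tgt (S.mul (S.mul x p) y) = G mu
    rw [S.tgt_mul _ y h3]; exact hy2

/-- Data for a Rees matrix construction with zero over a semigroupoid `S`:
indexing functions `F`, `G` surjective onto the sets of sources and of targets
respectively, and a sandwich matrix `P` with entries in `S^1 ∪ {0}`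
(`none` representing `0`) compatible with `F` and `G`. -/
structure Data0 (S : Sgpd O A) (I Λ : Type) where
  F : I → O
  G : Λ → O
  P : Λ → I → Option A
  F_into : ∀ i, ∃ a : A, S.src a = F i
  F_onto : ∀ a : A, ∃ i, F i = S.src a
  G_into : ∀ lam, ∃ a : A, S.tgt a = G lam
  G_onto : ∀ a : A, ∃ lam, G lam = S.tgt a
  P_src : ∀ lam i p, P lam i = some p → S.src p = G lam
  P_tgt : ∀ lam i p, P lam i = some p → S.tgt p = F i

/-- Underlying set of the Rees matrix semigroup with zero (`none` is the zero). -/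
def Carrier0 (S : Sgpd O A) (R : Data0 S I Λ) : Type :=
  Option (Triples S R.F R.G)

/-- Multiplication of the Rees matrix semigroup with zero. -/
def mul0 (S : Sgpd O A) (R : Data0 S I Λ) :
    Carrier0 S R → Carrier0 S R → Carrier0 S R
  | some ⟨(i, x, lam), hx⟩, some ⟨(j, y, mu), hy⟩ =>
    match hp : R.P lam j with
    | some p => some ⟨(i, S.mul (S.mul x p) y, mu),
        prod_valid S hx hy (R.P_src lam j p hp) (R.P_tgt lam j p hp)⟩
    | none => none
  | none, _ => none
  | _, none => none

/-- The Rees matrix semigroup with zero `M^0(S; F(I), G(Λ); P)`, as a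
one-object semigroupoid (i.e. a semigroup). -/
def pre0 (S : Sgpd O A) (R : Data0 S I Λ) : PreSgpd Unit (Carrier0 S R) where
  src _ := ()
  tgt _ := ()
  mul := mul0 S R

/-- Data for a Rees matrix construction without zero (no zero entries in `P`). -/
structure Data (S : Sgpd O A) (I Λ : Type) where
  F : I → O
  G : Λ → O
  P : Λ → I → A
  F_into : ∀ i, ∃ a : A, S.src a = F i
  F_onto : ∀ a : A, ∃ i, F i = S.src a
  G_into : ∀ lam, ∃ a : A, S.tgt a = G lam
  G_onto : ∀ a : A, ∃ lam, G lam = S.tgt a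
  P_src : ∀ lam i, S.src (P lam i) = G lam
  P_tgt : ∀ lam i, S.tgt (P lam i) = F i

/-- Underlying set of the Rees matrix semigroup without zero. -/
def Carrier (S : Sgpd O A) (R : Data S I Λ) : Type :=
  Triples S R.F R.G

/-- Multiplication of the Rees matrix semigroup without zero. -/
def mul (S : Sgpd O A) (R : Data S I Λ) :
    Carrier S R → Carrier S R → Carrier S R
  | ⟨(i, x, lam), hx⟩, ⟨(j, y, mu), hy⟩ =>
    ⟨(i, S.mul (S.mul x (R.P lam j)) y, mu),
      prod_valid S hx hy (R.P_src lam j) (R.P_tgt lam j)⟩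

/-- The Rees matrix semigroup without zero `M(S; F(I), G(Λ); P)`, as a
one-object semigroupoid (i.e. a semigroup). -/
def pre (S : Sgpd O A) (R : Data S I Λ) : PreSgpd Unit (Carrier S R) where
  src _ := ()
  tgt _ := ()
  mul := mul S R

/-- The set `S P' S` of arrows of the form `s p t` with `p` a non-zero entry of `P`. -/
def SPS0 (S : Sgpd O A) (R : Data0 S I Λ) : Set A :=
  { a | ∃ s p t lam i, R.P lam i = some p ∧ S.tgt s = S.src p ∧ S.tgt p = S.src t ∧
        a = S.mul (S.mul s p) t }

/-- The set `S P S` for a matrix without zero entries. -/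
def SPS (S : Sgpd O A) (R : Data S I Λ) : Set A :=
  { a | ∃ s t lam i, S.tgt s = S.src (R.P lam i) ∧ S.tgt (R.P lam i) = S.src t ∧
        a = S.mul (S.mul s (R.P lam i)) t }

/-- The set of targets of arrows of `S` (the codomain of `G`). -/
def tgtSet (S : Sgpd O A) : Set O := { v | ∃ a : A, S.tgt a = v }

/-- `T` is strongly right-ideal-generated by a row cross-section of `P`. -/
def StronglyRIG0 (S : Sgpd O A) (R : Data0 S I Λ) (T : Set A) : Prop :=
  ∃ Λ' : Set Λ, Set.BijOn R.G Λ' (tgtSet S) ∧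
    ∀ t ∈ T, ∃ lam ∈ Λ', ∃ i p s, R.P lam i = some p ∧ S.tgt p = S.src s ∧
      t = S.mul p s

/-- `T` is weakly right-ideal-generated by a row cross-section of `P`. -/
def WeaklyRIG0 (S : Sgpd O A) (R : Data0 S I Λ) (T : Set A) : Prop :=
  ∃ Λ' : Set Λ, Set.BijOn R.G Λ' (tgtSet S) ∧
    ∀ t ∈ T, ∃ lam ∈ Λ', ∃ i p, R.P lam i = some p ∧
      (t = p ∨ ∃ s, S.tgt p = S.src s ∧ t = S.mul p s)

/-- Weak right-ideal generation, for a matrix without zero entries. -/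
def WeaklyRIG (S : Sgpd O A) (R : Data S I Λ) (T : Set A) : Prop :=
  ∃ Λ' : Set Λ, Set.BijOn R.G Λ' (tgtSet S) ∧
    ∀ t ∈ T, ∃ lam ∈ Λ', ∃ i,
      (t = R.P lam i ∨ ∃ s, S.tgt (R.P lam i) = S.src s ∧ t = S.mul (R.P lam i) s)

end Rees


namespace Aux

theorem fin_factor {X Y Z : Type*} (f : X → Y) (g : X → Z) (hg : (Set.range g).Finite)
    (h : ∀ x x', g x = g x' → f x = f x') : (Set.range f).Finite := by
  classical
  rcases isEmpty_or_nonempty X with hX | ⟨⟨x0⟩⟩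
  · rw [Set.range_eq_empty]; exact Set.finite_empty
  · refine (hg.image (fun z => if hz : ∃ x, g x = z then f hz.choose else f x0)).subset ?_
    rintro _ ⟨x, rfl⟩
    refine ⟨g x, ⟨x, rfl⟩, ?_⟩
    have hz : ∃ x', g x' = g x := ⟨x, rfl⟩
    simp only [dif_pos hz]
    exact h _ _ hz.choose_spec

theorem fin_pair {X Y Z : Type*} {f : X → Y} {g : X → Z} (hf : (Set.range f).Finite)
    (hg : (Set.range g).Finite) : (Set.range fun x => (f x, g x)).Finite := by
  refine (hf.prod hg).subset ?_
  rintro _ ⟨x, rfl⟩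
  exact ⟨⟨x, rfl⟩, ⟨x, rfl⟩⟩

theorem fin_comp {X Y Z : Type*} {f : X → Y} (hf : (Set.range f).Finite) (e : Z → X) :
    (Set.range fun z => f (e z)).Finite := by
  refine hf.subset ?_
  rintro _ ⟨x, rfl⟩
  exact ⟨e x, rfl⟩

theorem fin_of_mem {X Y : Type*} {f : X → Y} {s : Set Y} (hs : s.Finite) (h : ∀ x, f x ∈ s) :
    (Set.range f).Finite := by
  refine hs.subset ?_
  rintro _ ⟨x, rfl⟩
  exact h x

/-- Side condition: the shorter of the two prefixes has already ended. -/
def Side {α β : Type} (p : List α) (q : List β) (a : List α) (b : List β) : Prop :=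
  (p.length < q.length → a = []) ∧ (q.length < p.length → b = [])

/-- Residual of a relation. -/
def Res {α β : Type} (R : List α → List β → Prop) (p : List α) (q : List β) :
    List α → List β → Prop :=
  fun a b => Side p q a b ∧ R (p ++ a) (q ++ b)

/-- Finitely many residuals (relations). -/
def FinRes {α β : Type} (R : List α → List β → Prop) : Prop :=
  (Set.range fun pq : List α × List β => Res R pq.1 pq.2).Finite

/-- Finitely many residuals (languages). -/
def FinRes1 {α : Type} (D : List α → Prop) : Prop :=
  (Set.range fun p : List α => fun a : List α => D (p ++ a)).Finite

theorem finRes1_iff {α : Type} (D : List α → Prop) :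
    FinRes1 D ↔ IsRegularSet {w | D w} := by
  unfold IsRegularSet
  rw [Language.isRegular_iff_finite_range_leftQuotient]
  exact Iff.rfl

theorem fin_lt {α β : Type} :
    (Set.range fun pq : List α × List β =>
      (pq.1.length < pq.2.length, pq.2.length < pq.1.length)).Finite :=
  Set.toFinite _

theorem side_congr {α β : Type} {p p' : List α} {q q' : List β} {a b}
    (h : (p.length < q.length, q.length < p.length) =
      (p'.length < q'.length, q'.length < p'.length)) : Side p q a b ↔ Side p' q' a b := by
  have h1 := congrArg Prod.fst h
  have h2 := congrArg Prod.snd h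
  simp only [] at h1 h2
  unfold Side
  rw [h1, h2]

theorem FinRes.and {α β : Type} {R R' : List α → List β → Prop} (h : FinRes R) (h' : FinRes R') :
    FinRes (fun a b => R a b ∧ R' a b) := by
  refine fin_factor _ _ (fin_pair h h') ?_
  rintro ⟨p, q⟩ ⟨p', q'⟩ e
  simp only [Prod.mk.injEq] at e
  obtain ⟨e1, e2⟩ := e
  funext a b
  have e1 := congrFun (congrFun e1 a) b
  have e2 := congrFun (congrFun e2 a) b
  simp only [Res, eq_iff_iff] at *
  tauto

theorem FinRes.or {α β : Type} {R R' : List α → List β → Prop} (h : FinRes R) (h' : FinRes R') :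
    FinRes (fun a b => R a b ∨ R' a b) := by
  refine fin_factor _ _ (fin_pair h h') ?_
  rintro ⟨p, q⟩ ⟨p', q'⟩ e
  simp only [Prod.mk.injEq] at e
  obtain ⟨e1, e2⟩ := e
  funext a b
  have e1 := congrFun (congrFun e1 a) b
  have e2 := congrFun (congrFun e2 a) b
  simp only [Res, eq_iff_iff] at *
  tauto

theorem FinRes.false {α β : Type} : FinRes (fun (_ : List α) (_ : List β) => False) := by
  refine (Set.finite_singleton (fun (_ : List α) (_ : List β) => False)).subset ?_
  rintro _ ⟨x, rfl⟩
  simp only [Set.mem_singleton_iff]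
  funext a b
  simp [Res]

theorem FinRes.exists {α β ι : Type} [Finite ι] {R : ι → List α → List β → Prop}
    (h : ∀ i, FinRes (R i)) : FinRes (fun a b => ∃ i, R i a b) := by
  have key : ∀ s : Set ι, s.Finite → FinRes (fun a b => ∃ i ∈ s, R i a b) := by
    intro s hs
    induction s, hs using Set.Finite.induction_on with
    | empty => simpa using FinRes.false
    | insert _ _ ih => 
      rename_i i s _ _
      have := (h i).or ih
      simpa using this
  simpa using key Set.univ Set.finite_univ

theorem FinRes.rect {α β : Type} {D : List α → Prop} {D' : List β → Prop}
    (h : FinRes1 D) (h' : FinRes1 D') : FinRes (fun a b => D a ∧ D' b) := by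
  refine fin_factor _ _ (fin_pair fin_lt (fin_pair (fin_comp h Prod.fst) (fin_comp h' Prod.snd))) ?_
  rintro ⟨p, q⟩ ⟨p', q'⟩ e
  simp only [Prod.mk.injEq] at e
  obtain ⟨e0, e1, e2⟩ := e
  funext a b
  have e1 := congrFun e1 a
  have e2 := congrFun e2 b
  have e0 := side_congr (a := a) (b := b) (by simpa using e0)
  simp only [Res, eq_iff_iff] at *
  tauto

theorem FinRes1.and {α : Type} {D D' : List α → Prop}
    (h : FinRes1 D) (h' : FinRes1 D') : FinRes1 (fun a => D a ∧ D' a) := by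
  refine fin_factor _ _ (fin_pair h h') ?_
  intro p p' e
  simp only [Prod.mk.injEq] at e
  obtain ⟨e1, e2⟩ := e
  funext a
  have e1 := congrFun e1 a
  have e2 := congrFun e2 a
  simp only [eq_iff_iff] at *
  tauto

theorem FinRes1.or {α : Type} {D D' : List α → Prop}
    (h : FinRes1 D) (h' : FinRes1 D') : FinRes1 (fun a => D a ∨ D' a) := by
  refine fin_factor _ _ (fin_pair h h') ?_
  intro p p' e
  simp only [Prod.mk.injEq] at e
  obtain ⟨e1, e2⟩ := e
  funext a
  have e1 := congrFun e1 a
  have e2 := congrFun e2 a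
  simp only [eq_iff_iff] at *
  tauto

theorem FinRes1.exists {α ι : Type} [Finite ι] {R : ι → List α → Prop}
    (h : ∀ i, FinRes1 (R i)) : FinRes1 (fun a => ∃ i, R i a) := by
  have key : ∀ s : Set ι, s.Finite → FinRes1 (fun a => ∃ i ∈ s, R i a) := by
    intro s hs
    induction s, hs using Set.Finite.induction_on with
    | empty =>
      refine (Set.finite_singleton (fun (_ : List α) => False)).subset ?_
      rintro _ ⟨x, rfl⟩
      simp only [Set.mem_singleton_iff]
      funext a
      simp
    | insert _ _ ih => 
      rename_i i s _ _
      have := (h i).or ih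
      simpa using this
  simpa using key Set.univ Set.finite_univ

theorem FinRes1.singleton {α : Type} (x : α) : FinRes1 (fun l : List α => l = [x]) := by
  refine fin_factor _ (fun p : List α => (p = [], p = [x])) (Set.toFinite _) ?_
  intro p p' e
  simp only [Prod.mk.injEq, eq_iff_iff] at e
  funext a
  rcases p with _ | ⟨y, _ | ⟨z, p⟩⟩ <;> rcases p' with _ | ⟨y', _ | ⟨z', p'⟩⟩ <;>
    simp_all

theorem FinRes1.nonnil {α : Type} : FinRes1 (fun l : List α => l ≠ []) := by
  refine fin_factor _ (fun p : List α => (p = [])) (Set.toFinite _) ?_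
  intro p p' e
  simp only [eq_iff_iff] at e
  funext a
  simp [e]

theorem FinRes1.prefix {α : Type} {D : List α → Prop} (h : FinRes1 D) :
    FinRes1 (fun l => ∃ m, D m ∧ l <+: m) := by
  refine fin_factor _ _ h ?_
  intro p p' e
  have e : ∀ a, D (p ++ a) ↔ D (p' ++ a) := fun a => by simpa using congrFun e a
  funext a
  simp only [eq_iff_iff]
  constructor
  · rintro ⟨_, h1, t, rfl⟩
    refine ⟨p' ++ a ++ t, ?_, t, rfl⟩
    rw [List.append_assoc] at h1 ⊢
    exact (e _).1 h1
  · rintro ⟨_, h1, t, rfl⟩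
    refine ⟨p ++ a ++ t, ?_, t, rfl⟩
    rw [List.append_assoc] at h1 ⊢
    exact (e _).2 h1

theorem FinRes.comp {α β γ : Type} {R : List α → List β → Prop} {R' : List β → List γ → Prop}
    (h : FinRes R) (h' : FinRes R') : FinRes (fun a c => ∃ b, R a b ∧ R' b c) := by
  let Φ : List α × List γ → Set (Prop × (List α → List β → Prop) × (List β → List γ → Prop)) :=
    fun pq => {t | ∃ r : List β, r.length ≤ max pq.1.length pq.2.length ∧
      t = (r.length < max pq.1.length pq.2.length, Res R pq.1 r, Res R' r pq.2)}
  have hΦ : (Set.range Φ).Finite := by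
    have : (Set.univ ×ˢ ((Set.range fun pq : List α × List β => Res R pq.1 pq.2) ×ˢ
      (Set.range fun pq : List β × List γ => Res R' pq.1 pq.2)) : Set (Prop × _ × _)).Finite :=
      Set.finite_univ.prod (Set.Finite.prod h h')
    refine fin_of_mem this.finite_subsets ?_
    rintro ⟨p, q⟩ _ ⟨r, -, rfl⟩
    exact ⟨trivial, ⟨(p, r), rfl⟩, ⟨(r, q), rfl⟩⟩
  have key : ∀ p q a b, Res (fun a c => ∃ b, R a b ∧ R' b c) p q a b ↔
      Side p q a b ∧ ∃ t ∈ Φ (p, q), ∃ m, (t.1 → m = []) ∧ t.2.1 a m ∧ t.2.2 m b := by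
    intro p q a b
    constructor
    · rintro ⟨hs, m, h1, h2⟩
      refine ⟨hs, _, ⟨m.take (max p.length q.length), List.length_take_le _ _, rfl⟩,
        m.drop (max p.length q.length), ?_, ⟨?_, ?_⟩, ⟨?_, ?_⟩⟩
      · simp only [List.length_take]
        intro hm
        rw [List.drop_eq_nil_iff]; omega
      · obtain ⟨s1, s2⟩ := hs
        refine ⟨fun hh => s1 ?_, fun hh => ?_⟩
        · simp only [List.length_take] at hh; omega
        · simp only [List.length_take] at hh
          rw [List.drop_eq_nil_iff]; omega
      · rwa [List.take_append_drop]
      · obtain ⟨s1, s2⟩ := hs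
        refine ⟨fun hh => ?_, fun hh => s2 ?_⟩
        · simp only [List.length_take] at hh
          rw [List.drop_eq_nil_iff]; omega
        · simp only [List.length_take] at hh; omega
      · rwa [List.take_append_drop]
    · rintro ⟨hs, _, ⟨r, -, rfl⟩, m, -, ⟨-, h1⟩, ⟨-, h2⟩⟩
      exact ⟨hs, r ++ m, h1, h2⟩
  refine fin_factor _ _ (fin_pair fin_lt hΦ) ?_
  rintro ⟨p, q⟩ ⟨p', q'⟩ e
  obtain ⟨e0, e1⟩ := Prod.mk.inj e
  funext a b
  have e0 := side_congr (a := a) (b := b) e0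
  simp only [eq_iff_iff]
  rw [key, key, e0, e1]

theorem FinRes.decode {α β : Type} [Finite β] {R : List β → List β → Prop} (hR : FinRes R)
    (f : α → List β) (k : ℕ) {D1 D2 : List α → Prop} (h1 : FinRes1 D1) (h2 : FinRes1 D2)
    (hk : ∀ P Q, (∃ a, D1 (P ++ a)) → (∃ b, D2 (Q ++ b)) →
      (P.length ≤ Q.length → (P.flatMap f).length ≤ (Q.flatMap f).length + k) ∧
      (Q.length ≤ P.length → (Q.flatMap f).length ≤ (P.flatMap f).length + k)) :
    FinRes (fun U V => D1 U ∧ D2 V ∧ R (U.flatMap f) (V.flatMap f)) := by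
  have ex : ∀ PQ : List α × List α, ∃ t : (List β × List β) × (List β × List β),
      (t.2.1.length ≤ k ∧ t.2.2.length ≤ k) ∧ ((∃ a, D1 (PQ.1 ++ a)) → (∃ b, D2 (PQ.2 ++ b)) →
        ∀ a b, Side PQ.1 PQ.2 a b → (R ((PQ.1 ++ a).flatMap f) ((PQ.2 ++ b).flatMap f) ↔
          Res R t.1.1 t.1.2 (t.2.1 ++ a.flatMap f) (t.2.2 ++ b.flatMap f))) := by
    rintro ⟨P, Q⟩
    by_cases hP : ∃ a, D1 (P ++ a)
    swap
    · exact ⟨(([], []), ([], [])), ⟨by simp, by simp⟩, fun h => absurd h hP⟩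
    by_cases hQ : ∃ a, D2 (Q ++ a)
    swap
    · exact ⟨(([], []), ([], [])), ⟨by simp, by simp⟩, fun _ h => absurd h hQ⟩
    obtain ⟨k1, k2⟩ := hk P Q hP hQ
    simp only [List.flatMap_append]
    generalize P.flatMap f = p at *
    generalize Q.flatMap f = q at *
    by_cases c1 : p.length ≤ q.length ∧ Q.length ≤ P.length
    · refine ⟨((p, q.take p.length), ([], q.drop p.length)), ⟨by simp, ?_⟩, ?_⟩
      · have := k2 c1.2
        simp only [List.length_drop]; omega
      · intro _ _ a b _
        have hl : (q.take p.length).length = p.length := by simp; omega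
        unfold Res Side
        simp only [hl, lt_irrefl, List.nil_append, ← List.append_assoc, List.take_append_drop]
        simp
    by_cases c2 : q.length ≤ p.length ∧ P.length ≤ Q.length
    · refine ⟨((p.take q.length, q), (p.drop q.length, [])), ⟨?_, by simp⟩, ?_⟩
      · have := k1 c2.2
        simp only [List.length_drop]; omega
      · intro _ _ a b _
        have hl : (p.take q.length).length = q.length := by simp; omega
        unfold Res Side
        simp only [hl, lt_irrefl, List.nil_append, ← List.append_assoc, List.take_append_drop]
        simp
    refine ⟨((p, q), ([], [])), ⟨by simp, by simp⟩, ?_⟩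
    rintro _ _ a b ⟨s1, s2⟩
    unfold Res Side
    simp only [List.nil_append]
    refine ⟨fun h => ⟨⟨fun hh => ?_, fun hh => ?_⟩, h⟩, fun h => h.2⟩
    · rw [s1 (by omega)]; rfl
    · rw [s2 (by omega)]; rfl
  choose t ht1 ht2 using ex
  have hfin : (Set.range fun PQ : List α × List α => (t PQ).2).Finite :=
    fin_of_mem ((List.finite_length_le β k).prod (List.finite_length_le β k))
      (fun PQ => ht1 PQ)
  have hres : (Set.range fun PQ : List α × List α => Res R (t PQ).1.1 (t PQ).1.2).Finite :=
    fin_comp hR (fun PQ => (t PQ).1)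
  refine fin_factor _ _ (fin_pair fin_lt (fin_pair (fin_pair (fin_comp h1 Prod.fst)
    (fin_comp h2 Prod.snd)) (fin_pair hfin hres))) ?_
  rintro PQ PQ' e
  obtain ⟨e0, e'⟩ := Prod.mk.inj e
  obtain ⟨e12, e34⟩ := Prod.mk.inj e'
  obtain ⟨e1, e2⟩ := Prod.mk.inj e12
  obtain ⟨e3, e4⟩ := Prod.mk.inj e34
  funext a b
  have e0 := side_congr (a := a) (b := b) e0
  have e1 : D1 (PQ.1 ++ a) ↔ D1 (PQ'.1 ++ a) := by simpa using congrFun e1 a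
  have e2 : D2 (PQ.2 ++ b) ↔ D2 (PQ'.2 ++ b) := by simpa using congrFun e2 b
  simp only [Res, eq_iff_iff] at e4 ⊢
  constructor
  · rintro ⟨hs, g1, g2, g3⟩
    refine ⟨e0.1 hs, e1.1 g1, e2.1 g2, ?_⟩
    rw [ht2 _ ⟨a, e1.1 g1⟩ ⟨b, e2.1 g2⟩ a b (e0.1 hs)]
    rw [ht2 _ ⟨a, g1⟩ ⟨b, g2⟩ a b hs] at g3
    unfold Res at *
    have := congrFun (congrFun e4 ((t PQ).2.1 ++ a.flatMap f)) ((t PQ).2.2 ++ b.flatMap f)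
    rw [← e3]
    exact this.mp g3
  · rintro ⟨hs, g1, g2, g3⟩
    refine ⟨e0.2 hs, e1.2 g1, e2.2 g2, ?_⟩
    rw [ht2 _ ⟨a, e1.2 g1⟩ ⟨b, e2.2 g2⟩ a b (e0.2 hs)]
    rw [ht2 _ ⟨a, g1⟩ ⟨b, g2⟩ a b hs] at g3
    unfold Res at *
    have := congrFun (congrFun e4 ((t PQ').2.1 ++ a.flatMap f)) ((t PQ').2.2 ++ b.flatMap f)
    rw [e3]
    exact this.mpr g3

theorem FinRes1.decode {α β : Type} {K : List β → Prop} (hK : FinRes1 K)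
    (f : α → List β) {D1 : List α → Prop} (h1 : FinRes1 D1) :
    FinRes1 (fun U => D1 U ∧ K (U.flatMap f)) := by
  refine fin_factor _ _ (fin_pair h1 (fin_comp hK (fun p => p.flatMap f))) ?_
  intro p p' e
  obtain ⟨e1, e2⟩ := Prod.mk.inj e
  funext a
  have e1 := congrFun e1 a
  have e2 := congrFun e2 (a.flatMap f)
  simp only [List.flatMap_append, eq_iff_iff] at *
  tauto

end Aux

namespace Aux

/-- Convolution with explicit padding symbols. -/
def dd {σ E : Type} (s t : E ⊕ σ) : List E → List E → List ((E ⊕ σ) × (E ⊕ σ))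
  | [], [] => []
  | [], y :: b => (s, Sum.inl y) :: dd s t [] b
  | x :: a, [] => (Sum.inl x, t) :: dd s t a []
  | x :: a, y :: b => (Sum.inl x, Sum.inl y) :: dd s t a b

theorem dd_nil_left {σ E : Type} (s t : E ⊕ σ) (b : List E) :
    dd s t [] b = b.map (fun e => (s, Sum.inl e)) := by
  induction b with
  | nil => simp [dd]
  | cons y b ih => simp [dd, ih]

theorem dd_nil_right {σ E : Type} (s t : E ⊕ σ) (a : List E) :
    dd s t a [] = a.map (fun e => (Sum.inl e, t)) := by
  induction a with
  | nil => simp [dd]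
  | cons y b ih => simp [dd, ih]

theorem zip_eq_dd {σ E : Type} (s t : E ⊕ σ) (a b : List E) :
    (a.map Sum.inl).zip (b.map Sum.inl) ++
    (if a.length ≤ b.length
      then (b.drop a.length).map (fun e => (s, Sum.inl e))
      else (a.drop b.length).map (fun e => (Sum.inl e, t))) = dd s t a b := by
  induction a generalizing b with
  | nil => simp [dd_nil_left]
  | cons x a ih =>
    cases b with
    | nil => simp [dd_nil_right]
    | cons y b =>
      rw [dd, ← ih]
      simp

theorem deltaPair_eq {V E : Type} (etgt : E → V) (a b : List E) :
    deltaPair etgt a b = dd (padSym etgt a) (padSym etgt b) a b := zip_eq_dd _ _ _ _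

theorem dd_congr {σ E : Type} {s t s' t' : E ⊕ σ} (p q : List E)
    (hs : p.length < q.length → s = s') (ht : q.length < p.length → t = t') :
    dd s t p q = dd s' t' p q := by
  induction p generalizing q with
  | nil =>
    cases q with
    | nil => simp [dd]
    | cons y q => rw [hs (by simp), dd_nil_left, dd_nil_left]
  | cons x p ih =>
    cases q with
    | nil => rw [ht (by simp), dd_nil_right, dd_nil_right]
    | cons y q =>
      rw [dd, dd, ih q]
      · intro h; apply hs; simpa using h
      · intro h; apply ht; simpa using h

theorem dd_append {σ E : Type} (s t : E ⊕ σ) (p q a b : List E) (h : Side p q a b) :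
    dd s t (p ++ a) (q ++ b) = dd s t p q ++ dd s t a b := by
  induction p generalizing q with
  | nil =>
    cases q with
    | nil => simp [dd]
    | cons y q => 
      obtain rfl := h.1 (by simp)
      simp [dd_nil_left]
  | cons x p ih =>
    cases q with
    | nil => 
      obtain rfl := h.2 (by simp)
      simp [dd_nil_right]
    | cons y q =>
      simp only [dd, List.cons_append]
      rw [ih q]
      simpa [Side] using h

theorem delta_append {V E : Type} (etgt : E → V) (p q a b : List E) (h : Side p q a b) :
    deltaPair etgt (p ++ a) (q ++ b) = deltaPair etgt p q ++
      dd (padSym etgt (p ++ a)) (padSym etgt (q ++ b)) a b := by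
  rw [deltaPair_eq, deltaPair_eq, dd_append _ _ _ _ _ _ h]
  congr 1
  apply dd_congr
  · intro hh; rw [h.1 hh]; simp
  · intro hh; rw [h.2 hh]; simp

/-- Recover the first component. -/
def un1 {σ E : Type} (w : List ((E ⊕ σ) × (E ⊕ σ))) : List E := w.filterMap (fun x => x.1.getLeft?)
/-- Recover the second component. -/
def un2 {σ E : Type} (w : List ((E ⊕ σ) × (E ⊕ σ))) : List E := w.filterMap (fun x => x.2.getLeft?)

theorem un1_dd {σ E : Type} (s t : σ) (a b : List E) : un1 (dd (Sum.inr s) (Sum.inr t) a b) = a := by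
  induction a generalizing b with
  | nil => rw [dd_nil_left]; simp [un1]
  | cons x a ih => cases b <;> simpa [dd, un1] using ih _

theorem un2_dd {σ E : Type} (s t : σ) (a b : List E) : un2 (dd (Sum.inr s) (Sum.inr t) a b) = b := by
  induction b generalizing a with
  | nil => rw [dd_nil_right]; simp [un2]
  | cons y b ih =>
    cases a with
    | nil => simpa [dd, un2] using ih []
    | cons x a => simpa [dd, un2] using ih a

theorem un1_delta {V E : Type} (etgt : E → V) (a b : List E) : un1 (deltaPair etgt a b) = a := by
  rw [deltaPair_eq]; exact un1_dd _ _ _ _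

theorem un2_delta {V E : Type} (etgt : E → V) (a b : List E) : un2 (deltaPair etgt a b) = b := by
  rw [deltaPair_eq]; exact un2_dd _ _ _ _

theorem dd_split {σ E : Type} (s t : E ⊕ σ) (w z) (a' b' : List E) (h : dd s t a' b' = w ++ z) :
    ∃ p a q b, a' = p ++ a ∧ b' = q ++ b ∧ Side p q a b ∧ w = dd s t p q := by
  induction w generalizing a' b' with
  | nil => exact ⟨[], a', [], b', rfl, rfl, by simp [Side], by simp [dd]⟩
  | cons x w ih =>
    cases a' with
    | nil =>
      cases b' with
      | nil => simp [dd] at h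
      | cons y b' =>
        simp only [dd, List.cons_append, List.cons.injEq] at h
        obtain ⟨rfl, h⟩ := h
        obtain ⟨p, a, q, b, h1, rfl, h3, rfl⟩ := ih _ _ h
        obtain ⟨rfl, rfl⟩ : p = [] ∧ a = [] := by simpa using h1.symm
        exact ⟨[], [], y :: q, b, rfl, rfl, by simp [Side], by simp [dd]⟩
    | cons x a' =>
      cases b' with
      | nil =>
        simp only [dd, List.cons_append, List.cons.injEq] at h
        obtain ⟨rfl, h⟩ := h
        obtain ⟨p, a, q, b, rfl, h1, h3, rfl⟩ := ih _ _ h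
        obtain ⟨rfl, rfl⟩ : q = [] ∧ b = [] := by simpa using h1.symm
        exact ⟨x :: p, a, [], [], rfl, rfl, by simp [Side], by simp [dd]⟩
      | cons y b' =>
        simp only [dd, List.cons_append, List.cons.injEq] at h
        obtain ⟨rfl, h⟩ := h
        obtain ⟨p, a, q, b, rfl, rfl, h3, rfl⟩ := ih _ _ h
        exact ⟨x :: p, a, y :: q, b, rfl, rfl, by simpa [Side] using h3, by simp [dd]⟩

theorem delta_split {V E : Type} (etgt : E → V) (w z) (a' b' : List E)
    (h : deltaPair etgt a' b' = w ++ z) :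
    ∃ a b, a' = un1 w ++ a ∧ b' = un2 w ++ b ∧ Side (un1 w) (un2 w) a b ∧
      w = deltaPair etgt (un1 w) (un2 w) := by
  rw [deltaPair_eq] at h
  obtain ⟨p, a, q, b, rfl, rfl, hs, hw⟩ := dd_split _ _ _ _ _ _ h
  have hw' : w = deltaPair etgt p q := by
    rw [hw, deltaPair_eq]
    apply dd_congr
    · intro hh; rw [hs.1 hh]; simp
    · intro hh; rw [hs.2 hh]; simp
  have e1 : un1 w = p := by rw [hw', un1_delta]
  have e2 : un2 w = q := by rw [hw', un2_delta]
  rw [e1, e2]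
  exact ⟨a, b, rfl, rfl, hs, hw'⟩

theorem padSym_congr {V E : Type} (etgt : E → V) {p p' : List E} (h : p.getLast? = p'.getLast?)
    (a : List E) : padSym etgt (p ++ a) = padSym etgt (p' ++ a) := by
  simp [padSym, List.getLast?_append, h]

theorem finRes_of_sync {V E : Type} [Finite E] (etgt : E → V) {R : Set (List E × List E)}
    (h : SyncRegular etgt R) : FinRes (fun a b => (a, b) ∈ R) := by
  unfold SyncRegular IsRegularSet at h
  have h := h.finite_range_leftQuotient
  refine fin_factor _ _ (fin_pair fin_lt (fin_pair
    (fin_comp h (fun pq : List E × List E => deltaPair etgt pq.1 pq.2))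
    (Set.toFinite (Set.range (fun pq : List E × List E => (pq.1.getLast?, pq.2.getLast?)))))) ?_
  rintro ⟨p, q⟩ ⟨p', q'⟩ e
  obtain ⟨e0, e'⟩ := Prod.mk.inj e
  obtain ⟨e1, e34⟩ := Prod.mk.inj e'
  obtain ⟨e3, e4⟩ := Prod.mk.inj e34
  funext a b
  have e0 := side_congr (a := a) (b := b) e0
  simp only [Res, eq_iff_iff, e0]
  refine and_congr_right fun hs => ?_
  have key : ∀ p q : List E, (p, q) ∈ R ↔ ∃ r ∈ R, deltaPair etgt p q = deltaPair etgt r.1 r.2 := by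
    intro p q
    refine ⟨fun h => ⟨_, h, rfl⟩, ?_⟩
    rintro ⟨⟨r1, r2⟩, hr, e⟩
    have h1 := congrArg un1 e
    have h2 := congrArg un2 e
    rw [un1_delta, un1_delta] at h1
    rw [un2_delta, un2_delta] at h2
    simp only at h1 h2
    rwa [h1, h2]
  rw [key, key, delta_append _ _ _ _ _ hs, delta_append _ _ _ _ _ (e0.2 hs),
    padSym_congr etgt e3 a, padSym_congr etgt e4 b]
  have := congrFun e1 (dd (padSym etgt (p' ++ a)) (padSym etgt (q' ++ b)) a b)
  exact iff_of_eq this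

theorem sync_of_finRes {V E : Type} [Finite E] (etgt : E → V) {R : Set (List E × List E)}
    (h : FinRes (fun a b => (a, b) ∈ R)) : SyncRegular etgt R := by
  unfold SyncRegular IsRegularSet
  apply Language.IsRegular.of_finite_range_leftQuotient
  refine fin_factor _ (fun w : List ((E ⊕ Option V) × (E ⊕ Option V)) => ((w = deltaPair etgt (un1 w) (un2 w)),
    (Res (fun a b => (a, b) ∈ R) (un1 w) (un2 w), ((un1 w).getLast?, (un2 w).getLast?))))
    (fin_pair (Set.toFinite _) (fin_pair
    (fin_comp h (fun w => (un1 w, un2 w)))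
    (Set.toFinite _))) ?_
  intro w w' e
  obtain ⟨e0, e'⟩ := Prod.mk.inj e
  obtain ⟨e1, e34⟩ := Prod.mk.inj e'
  obtain ⟨e3, e4⟩ := Prod.mk.inj e34
  have key : ∀ w z, (∃ p ∈ R, w ++ z = deltaPair etgt p.1 p.2) ↔
      w = deltaPair etgt (un1 w) (un2 w) ∧ ∃ a b, Res (fun a b => (a, b) ∈ R) (un1 w) (un2 w) a b ∧
        z = dd (padSym etgt (un1 w ++ a)) (padSym etgt (un2 w ++ b)) a b := by
    intro w z
    constructor
    · rintro ⟨⟨a', b'⟩, hr, e⟩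
      obtain ⟨a, b, h1, h2, h3, h4⟩ := delta_split etgt w z a' b' e.symm
      refine ⟨h4, a, b, ⟨h3, ?_⟩, ?_⟩
      · rw [← h1, ← h2]; exact hr
      · simp only at e
        rw [h1, h2, delta_append _ _ _ _ _ h3, ← h4] at e
        exact List.append_cancel_left e
    · rintro ⟨h4, a, b, ⟨h3, hr⟩, hz⟩
      refine ⟨_, hr, ?_⟩
      rw [delta_append _ _ _ _ _ h3, ← h4, ← hz]
  ext z
  refine (key w z).trans (Iff.trans ?_ (key w' z).symm)
  rw [← e1, iff_of_eq e0]
  simp only [padSym_congr etgt e3, padSym_congr etgt e4]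

end Aux

namespace Aux

section Eval
variable {O A E : Type} {S : Sgpd O A}

theorem eval_single {S : PreSgpd O A} (lab : E → A) (a : E) : evalPath? S lab [a] = some (lab a) := rfl

theorem eval_snoc {S : PreSgpd O A} (lab : E → A) {l : List E} {x : A} (a : E)
    (h : evalPath? S lab l = some x) : evalPath? S lab (l ++ [a]) = some (S.mul x (lab a)) := by
  cases l with
  | nil => simp [evalPath?] at h
  | cons e l =>
    simp only [evalPath?, Option.some.injEq] at h
    simp [evalPath?, h]

theorem eval_some {S : PreSgpd O A} (lab : E → A) {l : List E} (h : l ≠ []) :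
    ∃ x, evalPath? S lab l = some x := by
  cases l with
  | nil => exact absurd rfl h
  | cons e l => exact ⟨_, rfl⟩

theorem eval_ne {S : PreSgpd O A} {lab : E → A} {l : List E} {x} (h : evalPath? S lab l = some x) :
    l ≠ [] := by
  rintro rfl; simp [evalPath?] at h

/-- Chain condition for the edges of a choice of representatives. -/
abbrev Ch {S : PreSgpd O A} (C : ChoiceOfReps S E) (l : List E) : Prop :=
  List.IsChain (fun e f => C.etgt e = C.esrc f) l

theorem eval_src_tgt (C : ChoiceOfReps S.toPreSgpd E) {l : List E} {x : A} (hc : Ch C l)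
    (h : evalPath? S.toPreSgpd C.lab l = some x) :
    pathSrc? C.esrc l = some (S.src x) ∧ pathTgt? C.etgt l = some (S.tgt x) := by
  induction l using List.reverseRecOn generalizing x with
  | nil => simp [evalPath?] at h
  | append_singleton l a ih =>
    rcases eq_or_ne l [] with rfl | hl
    · obtain rfl : C.lab a = x := by simpa [evalPath?] using h
      simp [pathSrc?, pathTgt?, C.lab_src, C.lab_tgt]
    · obtain ⟨y, hy⟩ := eval_some (S := S.toPreSgpd) C.lab hl
      rw [eval_snoc C.lab a hy] at h
      obtain rfl := Option.some.inj h
      rw [Ch, List.isChain_append] at hc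
      obtain ⟨h1, h2⟩ := ih hc.1 hy
      have ht : S.tgt y = S.src (C.lab a) := by
        rw [C.lab_src]
        simp only [pathTgt?, Option.map_eq_some_iff] at h2
        obtain ⟨e, he, he2⟩ := h2
        rw [← he2]
        exact hc.2.2 e he a (by simp)
      constructor
      · rw [S.src_mul _ _ ht, ← h1]
        cases l with
        | nil => exact absurd rfl hl
        | cons => simp [pathSrc?]
      · rw [S.tgt_mul _ _ ht]; simp [pathTgt?, C.lab_tgt]

theorem eval_append (C : ChoiceOfReps S.toPreSgpd E) {l r : List E} {x y : A} (hc : Ch C (l ++ r))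
    (hl : evalPath? S.toPreSgpd C.lab l = some x) (hr : evalPath? S.toPreSgpd C.lab r = some y) :
    S.tgt x = S.src y ∧ evalPath? S.toPreSgpd C.lab (l ++ r) = some (S.mul x y) := by
  have hcc := hc
  rw [Ch, List.isChain_append] at hcc
  obtain ⟨c1, c2, c3⟩ := hcc
  have hxy : S.tgt x = S.src y := by
    have a1 := (eval_src_tgt C c1 hl).2
    have a2 := (eval_src_tgt C c2 hr).1
    simp only [pathTgt?, pathSrc?, Option.map_eq_some_iff] at a1 a2
    obtain ⟨e, he, he2⟩ := a1
    obtain ⟨f, hf, hf2⟩ := a2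
    rw [← he2, ← hf2]; exact c3 e he f hf
  refine ⟨hxy, ?_⟩
  clear c3
  induction r using List.reverseRecOn generalizing y with
  | nil => simp [evalPath?] at hr
  | append_singleton r a ih =>
    rcases eq_or_ne r [] with rfl | hr0
    · obtain rfl : C.lab a = y := by simpa [evalPath?] using hr
      exact eval_snoc C.lab a hl
    · obtain ⟨z, hz⟩ := eval_some (S := S.toPreSgpd) C.lab hr0
      rw [eval_snoc C.lab a hz] at hr
      obtain rfl := Option.some.inj hr
      have c2' := c2
      rw [List.isChain_append] at c2'
      have hza : S.tgt z = S.src (C.lab a) := by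
        have a1 := (eval_src_tgt C c2'.1 hz).2
        simp only [pathTgt?, Option.map_eq_some_iff] at a1
        obtain ⟨e, he, he2⟩ := a1
        rw [← he2, C.lab_src]; exact c2'.2.2 e he a (by simp)
      rw [S.src_mul _ _ hza] at hxy
      have := ih (y := z) (by rw [← List.append_assoc] at hc; exact hc.left_of_append) hz c2'.1 hxy
      rw [← List.append_assoc, eval_snoc C.lab a this, S.mul_assoc' _ _ _ hxy hza]

theorem eval_ids (C : ChoiceOfReps S.toPreSgpd E) {b r : List E} {y : A} (hc : Ch C (b ++ r))
    (hb : ∀ e ∈ b, IsIdentity S.toPreSgpd (C.lab e))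
    (hr : evalPath? S.toPreSgpd C.lab r = some y) :
    evalPath? S.toPreSgpd C.lab (b ++ r) = some y := by
  induction b with
  | nil => simpa using hr
  | cons e b ih =>
    have h1 := ih (by exact hc.tail) (fun f hf => hb f (by simp [hf]))
    have h2 := eval_append C (l := [e]) (r := b ++ r) hc (eval_single _ e) h1
    have := (hb e (by simp)).1 y h2.1
    have h3 := h2.2
    rw [show S.mul (C.lab e) y = y from this] at h3
    exact h3

theorem eval_congr (C : ChoiceOfReps S.toPreSgpd E) {l r r' : List E} (hc : Ch C (l ++ r))
    (hc' : Ch C (l ++ r')) (hr : r ≠ [])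
    (h : evalPath? S.toPreSgpd C.lab r = evalPath? S.toPreSgpd C.lab r') :
    evalPath? S.toPreSgpd C.lab (l ++ r) = evalPath? S.toPreSgpd C.lab (l ++ r') := by
  rcases eq_or_ne l [] with rfl | hl
  · simpa using h
  · obtain ⟨x, hx⟩ := eval_some (S := S.toPreSgpd) C.lab hl
    obtain ⟨y, hy⟩ := eval_some (S := S.toPreSgpd) C.lab hr
    rw [(eval_append C hc hx hy).2, (eval_append C hc' hx (h ▸ hy)).2]

/-- Right multiplication relation by an arrow. -/
def RMul (C : ChoiceOfReps S.toPreSgpd E) (y : A) (u v : List E) : Prop :=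
  u ∈ C.K ∧ v ∈ C.K ∧ ∃ x, evalPath? S.toPreSgpd C.lab u = some x ∧ S.tgt x = S.src y ∧
    evalPath? S.toPreSgpd C.lab v = some (S.mul x y)

theorem RMul_lab (C : ChoiceOfReps S.toPreSgpd E) (a : E) (u v : List E) :
    RMul C (C.lab a) u v ↔ (u, v) ∈ relEdge C a := by
  unfold RMul relEdge
  simp only [Set.mem_ofPred_eq]
  refine and_congr_right fun hu => and_congr_right fun hv => ?_
  obtain ⟨x, hx⟩ := eval_some (S := S.toPreSgpd) C.lab (C.K_path u hu).1
  rw [(eval_src_tgt C (C.K_path u hu).2 hx).2, eval_snoc C.lab a hx, C.lab_src]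
  constructor
  · rintro ⟨x', h1, h2, h3⟩
    rw [hx] at h1
    obtain rfl := Option.some.inj h1
    exact ⟨by rw [h2], h3.symm⟩
  · rintro ⟨h1, h2⟩
    exact ⟨x, hx, Option.some.inj h1, h2.symm⟩

theorem RMul_mul (C : ChoiceOfReps S.toPreSgpd E) (y z : A) (hyz : S.tgt y = S.src z) (u v : List E) :
    RMul C (S.mul y z) u v ↔ ∃ w, RMul C y u w ∧ RMul C z w v := by
  constructor
  · rintro ⟨hu, hv, x, h1, h2, h3⟩
    rw [S.src_mul _ _ hyz] at h2
    obtain ⟨w, hw, hw2⟩ := C.K_onto (S.mul x y)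
    exact ⟨w, ⟨hu, hw, x, h1, h2, hw2⟩, hw, hv, _, hw2, by rw [S.tgt_mul _ _ h2, hyz],
      by rw [h3, S.mul_assoc' _ _ _ h2 hyz]⟩
  · rintro ⟨w, ⟨hu, hw, x, h1, h2, h3⟩, _, hv, x', h4, h5, h6⟩
    rw [h3] at h4
    obtain rfl := Option.some.inj h4
    exact ⟨hu, hv, x, h1, by rw [S.src_mul _ _ hyz, h2], by rw [h6, S.mul_assoc' _ _ _ h2 hyz]⟩

theorem RMul_finRes (C : ChoiceOfReps S.toPreSgpd E) (hC : IsAutomaticStructure C) (y : A) :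
    FinRes (RMul C y) := by
  have := hC.1
  have key : ∀ (l : List E) (y : A), Ch C l → evalPath? S.toPreSgpd C.lab l = some y →
      FinRes (RMul C y) := by
    intro l
    induction l using List.reverseRecOn with
    | nil => intro y _ h; simp [evalPath?] at h
    | append_singleton l a ih =>
      intro y hc h
      have ha : FinRes (RMul C (C.lab a)) := by
        have := finRes_of_sync C.etgt (hC.2.2.1 a)
        convert this using 3
        rw [RMul_lab]
      rcases eq_or_ne l [] with rfl | hl
      · obtain rfl : C.lab a = y := by simpa [evalPath?] using h
        exact ha
      · obtain ⟨z, hz⟩ := eval_some (S := S.toPreSgpd) C.lab hl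
        obtain ⟨e1, e2⟩ := eval_append C hc hz (eval_single _ a)
        rw [h] at e2
        obtain rfl := Option.some.inj e2
        have := (ih z hc.left_of_append hz).comp ha
        convert this using 3
        rw [RMul_mul C _ _ e1]
  obtain ⟨l, hl, hl2⟩ := C.K_onto y
  exact key l y (C.K_path l hl).2 hl2

theorem relEq_finRes (C : ChoiceOfReps S.toPreSgpd E) [Finite O] (hC : IsAutomaticStructure C) :
    FinRes (fun u v => u ∈ C.K ∧ v ∈ C.K ∧
      evalPath? S.toPreSgpd C.lab u = evalPath? S.toPreSgpd C.lab v) := by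
  have := hC.1
  have := FinRes.exists (fun v => finRes_of_sync C.etgt (hC.2.2.2 v))
  convert this using 3 with u v
  simp only [relVertex, Set.mem_ofPred_eq]
  constructor
  · rintro ⟨hu, hv, h⟩
    obtain ⟨x, hx⟩ := eval_some (S := S.toPreSgpd) C.lab (C.K_path u hu).1
    exact ⟨_, hu, hv, (eval_src_tgt C (C.K_path u hu).2 hx).2, h⟩
  · rintro ⟨_, hu, hv, _, h⟩
    exact ⟨hu, hv, h⟩

/-- Shortest representatives have a nonidentity letter in each long window. -/
theorem exists_rep (C : ChoiceOfReps S.toPreSgpd E) (hK : IsRegularSet C.K) :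
    ∃ N : ℕ, ∀ x : A, ∃ u ∈ C.K, evalPath? S.toPreSgpd C.lab u = some x ∧
      ∀ u1 w u2, u = u1 ++ w ++ u2 → w.length = N + 1 →
        ∃ e ∈ w.take N, ¬ IsIdentity S.toPreSgpd (C.lab e) := by
  classical
  obtain ⟨σ, hσ, D, hD⟩ := hK
  refine ⟨Fintype.card σ, fun x => ?_⟩
  have hex : ∃ n, ∃ u ∈ C.K, evalPath? S.toPreSgpd C.lab u = some x ∧ u.length = n := by
    obtain ⟨u, hu, hx⟩ := C.K_onto x
    exact ⟨_, u, hu, hx, rfl⟩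
  obtain ⟨u, hu, hx, hn⟩ := Nat.find_spec hex
  refine ⟨u, hu, hx, ?_⟩
  intro u1 w u2 he hw
  by_contra hcon
  push Not at hcon
  obtain ⟨q, a, b, c, hab, hl, hbne, e1, e2, e3⟩ := D.evalFrom_split (x := w.take (Fintype.card σ))
    (s := D.evalFrom D.start u1) (by simp [hw]) rfl
  have memK : ∀ l, l ∈ C.K ↔ D.evalFrom D.start l ∈ D.accept := fun l => by
    have : l ∈ D.accepts ↔ l ∈ C.K := by rw [hD]; rfl
    rw [← this]; rfl
  set r := c ++ w.drop (Fintype.card σ) ++ u2 with hr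
  have hw' : w = a ++ b ++ c ++ w.drop (Fintype.card σ) := by
    rw [← hab, List.take_append_drop]
  have hu' : u = (u1 ++ a) ++ (b ++ r) := by
    rw [he, hr]; conv_lhs => rw [hw']
    simp
  have hrne : r ≠ [] := by
    have : w.drop (Fintype.card σ) ≠ [] := by
      intro h; have := congrArg List.length h; simp [hw] at this
    simp [hr, this]
  have hv : (u1 ++ a) ++ r ∈ C.K := by
    rw [memK] at hu ⊢
    rw [hu'] at hu
    simp only [DFA.evalFrom_of_append] at hu ⊢
    rw [e1] at hu ⊢
    rwa [e2] at hu
  have hcu := (C.K_path u hu).2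
  have hcv := (C.K_path _ hv).2
  rw [hu'] at hcu
  obtain ⟨y, hy⟩ := eval_some (S := S.toPreSgpd) C.lab hrne
  have hbr := eval_ids C (b := b) (r := r) (y := y) hcu.right_of_append (fun e he => hcon e (by
    rw [hab]; simp [he])) hy
  have := eval_congr C hcu hcv (by simp [hrne]) (by rw [hbr, hy])
  rw [← hu', hx] at this
  refine Nat.find_min hex (m := ((u1 ++ a) ++ r).length) ?_ ⟨_, hv, this.symm, rfl⟩
  rw [← hn, hu']
  have : 0 < b.length := List.length_pos_of_ne_nil hbne
  simp only [List.length_append]; omega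

end Eval
end Aux

namespace Aux
open Rees

section ReesPart
variable {O A I Λ E : Type} {S : Sgpd O A} {R : Data0 S I Λ}

/-- The zero element. -/
def zero0 (S : Sgpd O A) (R : Data0 S I Λ) : Carrier0 S R := none

/-- `m` is the triple `(i, x, l)`. -/
def IsTriple (m : Carrier0 S R) (i : I) (x : A) (l : Λ) : Prop :=
  ∃ h : Valid S R.F R.G (i, x, l), m = some ⟨(i, x, l), h⟩

theorem IsTriple.inj {m : Carrier0 S R} {i i' x x' l l'} (h : IsTriple m i x l)
    (h' : IsTriple m i' x' l') : i = i' ∧ x = x' ∧ l = l' := by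
  obtain ⟨a, rfl⟩ := h
  obtain ⟨b, e⟩ := h'
  have := congrArg Subtype.val (Option.some.inj e)
  simpa using this

theorem IsTriple.ext {m m' : Carrier0 S R} {i x l} (h : IsTriple m i x l)
    (h' : IsTriple m' i x l) : m = m' := by
  obtain ⟨a, rfl⟩ := h
  obtain ⟨b, rfl⟩ := h'
  rfl

theorem IsTriple.ne {m : Carrier0 S R} {i x l} (h : IsTriple m i x l) : m ≠ zero0 S R := by
  obtain ⟨a, rfl⟩ := h
  intro h; cases h

theorem triple_or (m : Carrier0 S R) : m = zero0 S R ∨ ∃ i x l, IsTriple m i x l := by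
  rcases m with _ | ⟨⟨i, x, l⟩, h⟩
  · exact Or.inl rfl
  · exact Or.inr ⟨i, x, l, h, rfl⟩

theorem mul0_zero_left (m : Carrier0 S R) : mul0 S R (zero0 S R) m = zero0 S R := by
  rcases m with _ | ⟨⟨i, x, l⟩, h⟩ <;> rfl

theorem mul0_zero_right (m : Carrier0 S R) : mul0 S R m (zero0 S R) = zero0 S R := by
  rcases m with _ | ⟨⟨i, x, l⟩, h⟩ <;> rfl

theorem match_some {α β : Type} (o : Option α) (f : ∀ p, o = some p → β) (z : β) (p : α)
    (h : o = some p) : (match (generalizing := false) hp : o with | some p => f p hp | none => z) = f p h := by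
  subst h; rfl

theorem match_none {α β : Type} (o : Option α) (f : ∀ p, o = some p → β) (z : β)
    (h : o = none) : (match (generalizing := false) hp : o with | some p => f p hp | none => z) = z := by
  subst h; rfl

theorem IsTriple.mul {m n : Carrier0 S R} {i x l j y k p} (h : IsTriple m i x l)
    (h' : IsTriple n j y k) (hp : R.P l j = some p) :
    IsTriple (mul0 S R m n) i (S.mul (S.mul x p) y) k := by
  obtain ⟨a, rfl⟩ := h
  obtain ⟨b, rfl⟩ := h'
  refine ⟨prod_valid S a b (R.P_src _ _ _ hp) (R.P_tgt _ _ _ hp), ?_⟩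
  exact match_some (β := Carrier0 S R) (R.P l j)
    (fun p hp => some ⟨(i, S.mul (S.mul x p) y, k),
        prod_valid S a b (R.P_src l j p hp) (R.P_tgt l j p hp)⟩) none p hp

theorem IsTriple.mul_none {m n : Carrier0 S R} {i x l j y k} (h : IsTriple m i x l)
    (h' : IsTriple n j y k) (hp : R.P l j = none) :
    mul0 S R m n = zero0 S R := by
  obtain ⟨a, rfl⟩ := h
  obtain ⟨b, rfl⟩ := h'
  exact match_none (β := Carrier0 S R) (R.P l j)
    (fun p hp => some ⟨(i, S.mul (S.mul x p) y, k),
        prod_valid S a b (R.P_src l j p hp) (R.P_tgt l j p hp)⟩) none hp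

theorem IsTriple.mul_inv {m n : Carrier0 S R} {i x l} (h : IsTriple (mul0 S R m n) i x l) :
    (∃ x' l', IsTriple m i x' l') ∧ (∃ j y, IsTriple n j y l) := by
  rcases triple_or m with rfl | ⟨i', x', l', hm⟩
  · rw [mul0_zero_left] at h; exact absurd rfl h.ne
  rcases triple_or n with rfl | ⟨j, y, k, hn⟩
  · rw [mul0_zero_right] at h; exact absurd rfl h.ne
  rcases hp : R.P l' j with _ | p
  · rw [hm.mul_none hn hp] at h; exact absurd rfl h.ne
  · obtain ⟨rfl, -, rfl⟩ := (hm.mul hn hp).inj h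
    exact ⟨⟨_, _, hm⟩, ⟨_, _, hn⟩⟩

theorem gen_ends (l : List (Carrier0 S R)) {m i x k} (h : evalPath? (pre0 S R) id l = some m)
    (hm : IsTriple m i x k) :
    (∃ t ∈ l, ∃ x' k', IsTriple t i x' k') ∧ (∃ t ∈ l, ∃ j y, IsTriple t j y k) := by
  induction l using List.reverseRecOn generalizing m x k with
  | nil => simp [evalPath?] at h
  | append_singleton l a ih =>
    rcases eq_or_ne l [] with rfl | hl
    · obtain rfl : a = m := by simpa [evalPath?] using h
      exact ⟨⟨a, by simp, _, _, hm⟩, ⟨a, by simp, _, _, hm⟩⟩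
    · obtain ⟨z, hz⟩ := eval_some (S := pre0 S R) id hl
      rw [eval_snoc id a hz] at h
      obtain rfl := Option.some.inj h
      obtain ⟨⟨x', k', h1⟩, h2⟩ := IsTriple.mul_inv hm
      obtain ⟨⟨t, ht, hh⟩, -⟩ := ih hz h1
      exact ⟨⟨t, by simp [ht], hh⟩, ⟨a, by simp, h2⟩⟩

theorem finite_idx (hfg : IsFG (pre0 S R)) (hiso : IsolationFree S.toPreSgpd) :
    Finite I ∧ Finite Λ ∧ Finite O := by
  obtain ⟨T, hT, hgen⟩ := hfg
  have := hT.to_subtype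
  have hI : Finite I := by
    have : ∀ i : I, ∃ t : T, ∃ x k, IsTriple t.1 i x k := by
      intro i
      obtain ⟨a, ha⟩ := R.F_into i
      obtain ⟨k, hk⟩ := R.G_onto a
      obtain ⟨l, -, h2, -, h4⟩ := hgen (some ⟨(i, a, k), ha.symm, hk.symm⟩)
      obtain ⟨⟨t, ht, hh⟩, -⟩ := gen_ends l h4 ⟨⟨ha.symm, hk.symm⟩, rfl⟩
      exact ⟨⟨t, h2 t ht⟩, hh⟩
    choose f x k hf using this
    exact Finite.of_injective f (fun i j e => ((hf i).inj (e ▸ hf j)).1)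
  have hL : Finite Λ := by
    have : ∀ k : Λ, ∃ t : T, ∃ i x, IsTriple t.1 i x k := by
      intro k
      obtain ⟨a, ha⟩ := R.G_into k
      obtain ⟨i, hi⟩ := R.F_onto a
      obtain ⟨l, -, h2, -, h4⟩ := hgen (some ⟨(i, a, k), hi, ha⟩)
      obtain ⟨-, ⟨t, ht, hh⟩⟩ := gen_ends l h4 ⟨⟨hi, ha⟩, rfl⟩
      exact ⟨⟨t, h2 t ht⟩, hh⟩
    choose f i x hf using this
    exact Finite.of_injective f (fun k j e => ((hf k).inj (e ▸ hf j)).2.2)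
  refine ⟨hI, hL, ?_⟩
  refine Finite.of_surjective (Sum.elim R.F R.G) ?_
  intro v
  obtain ⟨a, rfl | rfl⟩ := hiso v
  · obtain ⟨i, hi⟩ := R.F_onto a; exact ⟨Sum.inl i, hi⟩
  · obtain ⟨i, hi⟩ := R.G_onto a; exact ⟨Sum.inr i, hi⟩

/-- `y` lies in the right ideal generated by an entry of row `l`, strictly. -/
def Good (R : Data0 S I Λ) (l : Λ) (y : A) : Prop :=
  ∃ j p s, R.P l j = some p ∧ S.tgt p = S.src s ∧ y = S.mul p s

theorem good_of_window (C : ChoiceOfReps S.toPreSgpd E)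
    (hrig : WeaklyRIG0 S R { a : A | ¬ IsIdentity S.toPreSgpd a }) (N : ℕ) (w : List E)
    (hw : w.length = N + 1) (hc : Ch C w) (h : ∃ e ∈ w.take N, ¬ IsIdentity S.toPreSgpd (C.lab e))
    {y : A} (hy : evalPath? S.toPreSgpd C.lab w = some y) : ∃ l, Good R l y := by
  obtain ⟨Λ', -, hr⟩ := hrig
  have main : ∀ (w : List E) (t : List E) (y : A), t ≠ [] → Ch C (w ++ t) →
      (∃ e ∈ w, ¬ IsIdentity S.toPreSgpd (C.lab e)) →
      evalPath? S.toPreSgpd C.lab (w ++ t) = some y → ∃ l, Good R l y := by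
    intro w
    induction w with
    | nil => rintro t y - - ⟨e, he, -⟩; simp at he
    | cons a w ih =>
      intro t y ht hc hh hy
      have hwt : w ++ t ≠ [] := by simp [ht]
      obtain ⟨z, hz⟩ := eval_some (S := S.toPreSgpd) C.lab hwt
      obtain ⟨h1, h2⟩ := eval_append C (l := [a]) (r := w ++ t) hc (eval_single _ a) hz
      have hyz : y = S.mul (C.lab a) z := by
        have : some y = some (S.mul (C.lab a) z) := by rw [← h2, ← hy]; rfl
        exact Option.some.inj this
      by_cases hid : IsIdentity S.toPreSgpd (C.lab a)
      · have : S.mul (C.lab a) z = z := hid.1 z h1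
        rw [hyz, this]
        refine ih t z ht hc.tail ?_ hz
        obtain ⟨e, he, hne⟩ := hh
        rcases List.mem_cons.1 he with rfl | he
        · exact absurd hid hne
        · exact ⟨e, he, hne⟩
      · obtain ⟨l, -, i, p, hp, hcase⟩ := hr _ hid
        rcases hcase with e | ⟨s, hs, e⟩
        · rw [e] at h1 hyz
          exact ⟨l, i, p, z, hp, h1, hyz⟩
        · rw [e] at h1 hyz
          rw [S.tgt_mul _ _ hs] at h1
          refine ⟨l, i, p, S.mul s z, hp, by rw [S.src_mul _ _ h1, hs], ?_⟩
          rw [hyz, S.mul_assoc' _ _ _ hs h1]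
  refine main (w.take N) (w.drop N) y ?_ (by rwa [List.take_append_drop]) h
    (by rwa [List.take_append_drop])
  intro h; have := congrArg List.length h; simp [hw] at this

/-- Blocks of bounded length. -/
abbrev Blk (E : Type) (c : ℕ) := {l : List E // l.length ≤ c}

/-- Alphabet for the Rees matrix semigroup. -/
abbrev Ltr (I Λ E : Type) (c : ℕ) := Option ((I ⊕ Λ) × Blk E c × Λ)

/-- Decoding of a letter. -/
def dc {I Λ E : Type} {c : ℕ} : Ltr I Λ E c → List E
  | none => []
  | some (_, w, _) => w.1

/-- Specification of the value of a letter. -/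
def Spec (R : Data0 S I Λ) (C : ChoiceOfReps S.toPreSgpd E) {c : ℕ} (e : Ltr I Λ E c)
    (m : Carrier0 S R) : Prop :=
  (e = none → m = zero0 S R) ∧
  (∀ i w k x, e = some (Sum.inl i, w, k) → evalPath? S.toPreSgpd C.lab w.1 = some x →
    Valid S R.F R.G (i, x, k) → IsTriple m i x k) ∧
  (∀ l w k y, e = some (Sum.inr l, w, k) → evalPath? S.toPreSgpd C.lab w.1 = some y →
    Good R l y → S.tgt y = R.G k →
    ∃ j p s, R.P l j = some p ∧ S.tgt p = S.src s ∧ y = S.mul p s ∧ IsTriple m j s k)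

theorem exists_spec (R : Data0 S I Λ) (C : ChoiceOfReps S.toPreSgpd E) {c : ℕ} (e : Ltr I Λ E c) :
    ∃ m, Spec R C e m := by
  rcases e with _ | ⟨i | l, w, k⟩
  · refine ⟨zero0 S R, fun _ => rfl, ?_, ?_⟩
    · intro _ _ _ _ h; cases h
    · intro _ _ _ _ h; cases h
  · by_cases h : ∃ x, evalPath? S.toPreSgpd C.lab w.1 = some x ∧ Valid S R.F R.G (i, x, k)
    · obtain ⟨x, hx, hv⟩ := h
      refine ⟨some ⟨_, hv⟩, ?_⟩
      refine ⟨(fun h => by cases h), ?_, (fun _ _ _ _ h => by cases h)⟩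
      intro i' w' k' x' h hx' hv'
      cases h
      rw [hx] at hx'; cases hx'
      exact ⟨hv, rfl⟩
    · refine ⟨zero0 S R, fun _ => rfl, ?_, fun _ _ _ _ h => by cases h⟩
      intro i' w' k' x' hh hx' hv'
      cases hh
      exact absurd ⟨_, hx', hv'⟩ h
  · by_cases h : ∃ y, evalPath? S.toPreSgpd C.lab w.1 = some y ∧ Good R l y ∧ S.tgt y = R.G k
    · obtain ⟨y, hy, ⟨j, p, s, hp, hs, e⟩, ht⟩ := h
      have hv : Valid S R.F R.G (j, s, k) := by
        constructor
        · show R.F j = S.src s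
          rw [← hs, R.P_tgt _ _ _ hp]
        · show S.tgt s = R.G k
          rw [← ht, e, S.tgt_mul _ _ hs]
      refine ⟨some ⟨_, hv⟩, ?_⟩
      refine ⟨(fun h => by cases h), (fun _ _ _ _ h => by cases h), ?_⟩
      intro i' w' k' x' h hx' hg' ht'
      cases h
      rw [hy] at hx'; cases hx'
      exact ⟨j, p, s, hp, hs, e, hv, rfl⟩
    · refine ⟨zero0 S R, fun _ => rfl, fun _ _ _ _ h => by (cases h), ?_⟩
      intro _ _ _ _ hh hxx hvv htt
      cases hh
      exact absurd ⟨_, hxx, hvv, htt⟩ h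

/-- Allowed first letters. -/
def HeadOK (R : Data0 S I Λ) (C : ChoiceOfReps S.toPreSgpd E) {c : ℕ} (i : I) (e : Ltr I Λ E c) : Prop :=
  ∃ w k x, e = some (Sum.inl i, w, k) ∧ evalPath? S.toPreSgpd C.lab w.1 = some x ∧
    Valid S R.F R.G (i, x, k)

/-- Allowed consecutive letters. -/
def Link (R : Data0 S I Λ) (C : ChoiceOfReps S.toPreSgpd E) {c : ℕ} (e1 e2 : Ltr I Λ E c) : Prop :=
  ∃ o1 w1 l w y k, e1 = some (o1, w1, l) ∧ e2 = some (Sum.inr l, w, k) ∧ w.1.length = c ∧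
    evalPath? S.toPreSgpd C.lab w.1 = some y ∧ Good R l y ∧ S.tgt y = R.G k

/-- Allowed last letters. -/
def LastOK {I Λ E : Type} {c : ℕ} (k : Λ) (e : Ltr I Λ E c) : Prop := ∃ o w, e = some (o, w, k)

/-- Well-formed encoded words. -/
def DI (R : Data0 S I Λ) (C : ChoiceOfReps S.toPreSgpd E) {c : ℕ} (i : I) (k : Λ)
    (U : List (Ltr I Λ E c)) : Prop :=
  (∃ e, U.head? = some e ∧ HeadOK R C i e) ∧ List.IsChain (Link R C) U ∧
    (∃ e, U.getLast? = some e ∧ LastOK k e)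

theorem DI_finRes (R : Data0 S I Λ) (C : ChoiceOfReps S.toPreSgpd E) {c : ℕ} [Finite I] [Finite Λ]
    [Finite E] (i : I) (k : Λ) : FinRes1 (DI R C (c := c) i k) := by
  have : Finite (Blk E c) := (List.finite_length_le E c).to_subtype
  refine fin_factor _ (fun p : List (Ltr I Λ E c) =>
    (p.head?, List.IsChain (Link R C) p, p.getLast?)) (Set.toFinite _) ?_
  intro p p' h
  simp only [Prod.mk.injEq] at h
  obtain ⟨h1, h2, h3⟩ := h
  funext a
  simp only [DI, List.head?_append, List.getLast?_append, List.isChain_append, h1, h2, h3]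

theorem chain_len (R : Data0 S I Λ) (C : ChoiceOfReps S.toPreSgpd E) {c : ℕ} (h : Ltr I Λ E c)
    (t : List (Ltr I Λ E c)) (hc : List.IsChain (Link R C) (h :: t)) :
    (t.flatMap dc).length = c * t.length := by
  induction t generalizing h with
  | nil => simp
  | cons a t ih =>
    have h1 := ih a hc.tail
    obtain ⟨o1, w1, l, w, y, k, -, rfl, hw, -⟩ := (List.isChain_cons_cons.1 hc).1
    rw [List.flatMap_cons, List.length_append, h1]
    simp only [dc, hw, List.length_cons]; ring

theorem dc_len {c : ℕ} (e : Ltr I Λ E c) : (dc e).length ≤ c := by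
  rcases e with _ | ⟨o, w, k⟩
  · simp [dc]
  · exact w.2

theorem chain_len' (R : Data0 S I Λ) (C : ChoiceOfReps S.toPreSgpd E) {c : ℕ}
    (t : List (Ltr I Λ E c)) (hc : List.IsChain (Link R C) t) :
    (t.flatMap dc).length ≤ c * t.length ∧ c * t.length ≤ (t.flatMap dc).length + c := by
  cases t with
  | nil => simp
  | cons h t =>
    have h1 := chain_len R C h t hc
    have h2 := dc_len h
    rw [List.flatMap_cons, List.length_append, h1, List.length_cons, mul_add]
    constructor <;> omega

theorem DI_hk (R : Data0 S I Λ) (C : ChoiceOfReps S.toPreSgpd E) {c : ℕ}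
    {D1 D2 : List (Ltr I Λ E c) → Prop} (h1 : ∀ U, D1 U → List.IsChain (Link R C) U)
    (h2 : ∀ U, D2 U → List.IsChain (Link R C) U) (P Q : List (Ltr I Λ E c))
    (hP : ∃ a, D1 (P ++ a)) (hQ : ∃ a, D2 (Q ++ a)) :
      (P.length ≤ Q.length → (P.flatMap dc).length ≤ (Q.flatMap dc).length + c) ∧
      (Q.length ≤ P.length → (Q.flatMap dc).length ≤ (P.flatMap dc).length + c) := by
  obtain ⟨a, ha⟩ := hP
  obtain ⟨b, hb⟩ := hQ
  have c1 := chain_len' R C P (h1 _ ha).left_of_append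
  have c2 := chain_len' R C Q (h2 _ hb).left_of_append
  constructor
  · intro h
    have := Nat.mul_le_mul_left c h
    omega
  · intro h
    have := Nat.mul_le_mul_left c h
    omega

theorem DI_prefix (R : Data0 S I Λ) (C : ChoiceOfReps S.toPreSgpd E) {c : ℕ} {i : I} {k : Λ}
    {U V : List (Ltr I Λ E c)} (h : DI R C i k U) (hV : V <+: U) (hne : V ≠ []) :
    ∃ k', DI R C i k' V := by
  obtain ⟨T, rfl⟩ := hV
  obtain ⟨⟨e, he, hh⟩, hc, -⟩ := h
  have hcV := hc.left_of_append
  have hhd : V.head? = some e := by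
    cases V with
    | nil => exact absurd rfl hne
    | cons => simpa using he
  have hlast : ∃ k' f, V.getLast? = some f ∧ LastOK k' f := by
    induction V using List.reverseRecOn with
    | nil => exact absurd rfl hne
    | append_singleton V f _ =>
      rcases List.eq_nil_or_concat' V with rfl | ⟨V', g, rfl⟩
      · obtain rfl : f = e := by simpa using hhd
        obtain ⟨w, k, x, rfl, -⟩ := hh
        exact ⟨k, _, List.getLast?_concat, _, _, rfl⟩
      · rw [List.isChain_append] at hcV
        obtain ⟨o1, w1, l, w, y, k, -, rfl, -⟩ := hcV.2.2 g (by simp) f (by simp)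
        exact ⟨k, _, List.getLast?_concat, _, _, rfl⟩
  obtain ⟨k', hl⟩ := hlast
  exact ⟨k', ⟨e, hhd, hh⟩, hcV, hl⟩

theorem DI_value (R : Data0 S I Λ) (C : ChoiceOfReps S.toPreSgpd E) {c : ℕ}
    (lab : Ltr I Λ E c → Carrier0 S R) (hlab : ∀ e, Spec R C e (lab e)) {i : I} {k : Λ}
    {U : List (Ltr I Λ E c)} (h : DI R C i k U) (hc : Ch C (U.flatMap dc)) :
    ∃ x m, evalPath? S.toPreSgpd C.lab (U.flatMap dc) = some x ∧
      evalPath? (pre0 S R) lab U = some m ∧ IsTriple m i x k := by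
  induction U using List.reverseRecOn generalizing k with
  | nil => obtain ⟨⟨e, he, -⟩, -⟩ := h; simp at he
  | append_singleton U f ih =>
    obtain ⟨⟨e, he, hh⟩, hch, ⟨g, hg, hl⟩⟩ := h
    obtain rfl : f = g := by simpa using hg
    rcases eq_or_ne U [] with rfl | hU
    · obtain rfl : f = e := by simpa using he
      obtain ⟨w, k', x, rfl, hx, hv⟩ := hh
      obtain ⟨o, w', hl⟩ := hl
      cases hl
      exact ⟨x, _, by simpa [dc] using hx, rfl, (hlab _).2.1 _ _ _ _ rfl hx hv⟩
    · obtain ⟨U', d, rfl⟩ := (List.eq_nil_or_concat' U).resolve_left hU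
      have hch' := hch
      rw [List.isChain_append] at hch'
      obtain ⟨o1, w1, l, w, y, k', rfl, rfl, hwl, hy, hgd, ht⟩ := hch'.2.2 d (by simp) f (by simp)
      obtain ⟨o, w', hl⟩ := hl
      cases hl
      rw [List.flatMap_append] at hc
      have hD : DI R C i l (U' ++ [some (o1, w1, l)]) := by
        refine ⟨⟨e, ?_, hh⟩, hch'.1, ⟨_, List.getLast?_concat, _, _, rfl⟩⟩
        cases U' <;> simpa using he
      obtain ⟨x, m, hx, hm, htr⟩ := ih hD hc.left_of_append
      obtain ⟨j, p, s, hp, hps, rfl, hts⟩ := (hlab (some (Sum.inr l, w, k))).2.2 _ _ _ _ rfl hy hgd ht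
      have h2 := eval_append C (r := dc (some (Sum.inr l, w, k) : Ltr I Λ E c))
        (by simpa using hc) hx hy
      have hxp := h2.1
      rw [S.src_mul _ _ hps] at hxp
      refine ⟨S.mul x (S.mul p s), _, ?_, eval_snoc lab _ hm, ?_⟩
      · rw [List.flatMap_append, ← h2.2]; simp
      · rw [← S.mul_assoc' _ _ _ hxp hps]
        exact htr.mul hts hp

theorem DI_encode (R : Data0 S I Λ) (C : ChoiceOfReps S.toPreSgpd E) {c : ℕ} (hc0 : 0 < c) (n : ℕ) :
    ∀ (u : List E) (i : I) (k : Λ) (x : A), u.length ≤ n → Ch C u →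
      evalPath? S.toPreSgpd C.lab u = some x → Valid S R.F R.G (i, x, k) →
      (∀ u1 w u2, u = u1 ++ w ++ u2 → w.length = c → ∀ y, evalPath? S.toPreSgpd C.lab w = some y →
        ∃ l, Good R l y) →
      ∃ U : List (Ltr I Λ E c), DI R C i k U ∧ U.flatMap dc = u := by
  induction n with
  | zero =>
    intro u i k x hn _ hx
    exact absurd (List.length_eq_zero_iff.1 (Nat.le_zero.1 hn)) (eval_ne hx)
  | succ n ih =>
    intro u i k x hn hc hx hv hw
    by_cases hlen : u.length ≤ c
    · refine ⟨[some (Sum.inl i, ⟨u, hlen⟩, k)], ⟨⟨_, rfl, _, _, x, rfl, hx, hv⟩, by simp,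
        ⟨_, rfl, _, _, rfl⟩⟩, by simp [dc]⟩
    · push Not at hlen
      obtain ⟨u', w, rfl, hwl⟩ : ∃ u' w, u = u' ++ w ∧ w.length = c :=
        ⟨u.take (u.length - c), u.drop (u.length - c), by simp, by simp; omega⟩
      rw [List.length_append] at hlen hn
      have hu' : u' ≠ [] := by rintro rfl; simp at hlen; omega
      have hw' : w ≠ [] := by rintro rfl; simp at hwl; omega
      obtain ⟨x', hx'⟩ := eval_some (S := S.toPreSgpd) C.lab hu'
      obtain ⟨y, hy⟩ := eval_some (S := S.toPreSgpd) C.lab hw'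
      obtain ⟨h1, h2⟩ := eval_append C hc hx' hy
      rw [hx] at h2
      obtain rfl := Option.some.inj h2
      obtain ⟨l, hl⟩ := hw u' w [] (by simp) hwl y hy
      have hGl : S.src y = R.G l := by
        obtain ⟨j, p, s, hp, hs, rfl⟩ := hl
        rw [S.src_mul _ _ hs, R.P_src _ _ _ hp]
      have hv1 : R.F i = S.src x' := by
        have := hv.1; simp only at this; rw [S.src_mul _ _ h1] at this; exact this
      have hv2 : S.tgt y = R.G k := by
        have := hv.2; simp only at this; rw [S.tgt_mul _ _ h1] at this; exact this
      obtain ⟨U, ⟨hU1, hU2, hU3⟩, hU4⟩ := ih u' i l x' (by omega) hc.left_of_append hx'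
        ⟨hv1, by simp only; rw [h1, hGl]⟩
        (fun u1 w' u2 e => hw u1 w' (u2 ++ w) (by rw [e]; simp))
      refine ⟨U ++ [some (Sum.inr l, ⟨w, hwl.le⟩, k)], ⟨?_, ?_, ⟨_, List.getLast?_concat, _, _, rfl⟩⟩, ?_⟩
      · obtain ⟨e, he, hh⟩ := hU1
        exact ⟨e, by simp [he], hh⟩
      · rw [List.isChain_append]
        refine ⟨hU2, by simp, ?_⟩
        obtain ⟨e, he, hh⟩ := hU3
        intro a ha b hb
        rw [he] at ha
        simp at ha hb
        subst ha; subst hb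
        obtain ⟨o, w1, rfl⟩ := hh
        exact ⟨o, w1, l, ⟨w, hwl.le⟩, y, k, rfl, rfl, hwl, hy, hl, hv2⟩
      · rw [List.flatMap_append, hU4]; simp [dc]

end ReesPart
end Aux

namespace Aux
open Rees

section Final
variable {O A I Λ E : Type} {S : Sgpd O A} {R : Data0 S I Λ}

/-- The language of representatives for the Rees matrix semigroup. -/
def KM (R : Data0 S I Λ) (C : ChoiceOfReps S.toPreSgpd E) (c : ℕ) (U : List (Ltr I Λ E c)) : Prop :=
  U = [none] ∨ ∃ ik : I × Λ, DI R C ik.1 ik.2 U ∧ U.flatMap dc ∈ C.K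

theorem KM_finRes (R : Data0 S I Λ) (C : ChoiceOfReps S.toPreSgpd E) (c : ℕ) [Finite I] [Finite Λ]
    [Finite E] (hK : IsRegularSet C.K) : FinRes1 (KM R C c) :=
  FinRes1.or (FinRes1.singleton none) (FinRes1.exists fun ik : I × Λ =>
    FinRes1.decode (K := fun l => l ∈ C.K) ((finRes1_iff _).2 hK) dc (DI_finRes R C ik.1 ik.2))

theorem KM_class (R : Data0 S I Λ) (C : ChoiceOfReps S.toPreSgpd E) {c : ℕ}
    (lab : Ltr I Λ E c → Carrier0 S R) (hlab : ∀ e, Spec R C e (lab e))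
    {U : List (Ltr I Λ E c)} (h : KM R C c U) :
    (U = [none] ∧ evalPath? (pre0 S R) lab U = some (zero0 S R)) ∨
    ∃ i k x m, DI R C i k U ∧ U.flatMap dc ∈ C.K ∧
      evalPath? S.toPreSgpd C.lab (U.flatMap dc) = some x ∧
      evalPath? (pre0 S R) lab U = some m ∧ IsTriple m i x k := by
  rcases h with rfl | ⟨⟨i, k⟩, h1, h2⟩
  · exact Or.inl ⟨rfl, by rw [eval_single, (hlab none).1 rfl]⟩
  · obtain ⟨x, m, a, b, d⟩ := DI_value R C lab hlab h1 (C.K_path _ h2).2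
    exact Or.inr ⟨i, k, x, m, h1, h2, a, b, d⟩

theorem KM_prefix (R : Data0 S I Λ) (C : ChoiceOfReps S.toPreSgpd E) {c : ℕ}
    {U V : List (Ltr I Λ E c)} (h : KM R C c U) (hV : V <+: U) (hne : V ≠ []) :
    V = [none] ∨ ∃ i k, DI R C i k V ∧ V.flatMap dc ∈ prefs C.K := by
  rcases h with rfl | ⟨⟨i, k⟩, h1, h2⟩
  · left
    obtain ⟨T, hT⟩ := hV
    cases V with
    | nil => exact absurd rfl hne
    | cons a V => simp at hT; simp [hT]
  · right
    obtain ⟨k', hD⟩ := DI_prefix R C h1 hV hne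
    refine ⟨i, k', hD, ?_, _, h2, ?_⟩
    · obtain ⟨⟨e, he, w, k, x, rfl, hx, -⟩, -⟩ := hD
      cases V with
      | nil => exact absurd rfl hne
      | cons a V =>
        obtain rfl : a = some (Sum.inl i, w, k) := by simpa using he
        have := eval_ne hx
        simp [dc, this]
    · obtain ⟨T, rfl⟩ := hV
      rw [List.flatMap_append]; exact List.prefix_append _ _

theorem prefs_path (C : ChoiceOfReps S.toPreSgpd E) {u : List E} (h : u ∈ prefs C.K) : Ch C u := by
  obtain ⟨-, l, hl, T, rfl⟩ := h
  exact (C.K_path _ hl).2.left_of_append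

/-- Right multiplication by a fixed element of the Rees matrix semigroup. -/
theorem RM_finRes (R : Data0 S I Λ) (C : ChoiceOfReps S.toPreSgpd E) {c : ℕ} [Finite I] [Finite Λ]
    (hC : IsAutomaticStructure C)
    (lab : Ltr I Λ E c → Carrier0 S R) (hlab : ∀ e, Spec R C e (lab e)) (n : Carrier0 S R) :
    FinRes (fun U V => KM R C c U ∧ KM R C c V ∧ ∃ m, evalPath? (pre0 S R) lab U = some m ∧
      evalPath? (pre0 S R) lab V = some (mul0 S R m n)) := by
  have hE := hC.1
  have hz : KM R C c [none] := Or.inl rfl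
  have ez : evalPath? (pre0 S R) lab [none] = some (zero0 S R) := by
    rw [eval_single, (hlab none).1 rfl]
  have zu : ∀ V, KM R C c V → evalPath? (pre0 S R) lab V = some (zero0 S R) → V = [none] := by
    intro V hV e
    rcases KM_class R C lab hlab hV with h | ⟨i, k, x, m, -, -, -, h, ht⟩
    · exact h.1
    · rw [h] at e; exact absurd (Option.some.inj e) ht.ne
  rcases triple_or n with rfl | ⟨j, y, μ, hn⟩
  · have := FinRes.rect (KM_finRes R C c hC.2.1) (FinRes1.singleton (none : Ltr I Λ E c))
    convert this using 3 with U V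
    constructor
    · rintro ⟨hU, hV, m, -, e⟩
      rw [mul0_zero_right] at e
      exact ⟨hU, zu V hV e⟩
    · rintro ⟨hU, rfl⟩
      obtain ⟨m, hm⟩ := eval_some (S := pre0 S R) lab (l := U) (by
        rcases hU with rfl | ⟨_, ⟨⟨e, he, -⟩, -⟩, -⟩
        · simp
        · rintro rfl; simp at he)
      exact ⟨hU, hz, m, hm, by rw [mul0_zero_right, ez]⟩
  · have hrel : FinRes (fun U V : List (Ltr I Λ E c) => (U = [none] ∧ V = [none]) ∨
        ∃ ik : I × Λ, (R.P ik.2 j = none ∧ (DI R C ik.1 ik.2 U ∧ U.flatMap dc ∈ C.K) ∧ V = [none]) ∨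
          ∃ p, R.P ik.2 j = some p ∧ DI R C ik.1 ik.2 U ∧ DI R C ik.1 μ V ∧
            RMul C (S.mul p y) (U.flatMap dc) (V.flatMap dc)) := by
      refine FinRes.or (FinRes.rect (FinRes1.singleton none) (FinRes1.singleton none))
        (FinRes.exists fun ik => ?_)
      rcases hp : R.P ik.2 j with _ | p
      · convert FinRes.rect (FinRes1.decode (K := fun l => l ∈ C.K) ((finRes1_iff _).2 hC.2.1) dc
          (DI_finRes R C ik.1 ik.2)) (FinRes1.singleton (none : Ltr I Λ E c)) using 3 with U V
        simp
      · convert FinRes.decode (RMul_finRes C hC (S.mul p y)) dc c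
          (DI_finRes R C ik.1 ik.2) (DI_finRes R C (c := c) ik.1 μ)
          (DI_hk R C (fun U h => h.2.1) (fun U h => h.2.1)) using 3 with U V
        simp
    convert hrel using 3 with U V
    constructor
    · rintro ⟨hU, hV, m, hm, e⟩
      rcases KM_class R C lab hlab hU with ⟨rfl, h⟩ | ⟨i, k, x, m', hD, hK, hx, h, ht⟩
      · rw [h] at hm
        obtain rfl := Option.some.inj hm
        rw [mul0_zero_left] at e
        exact Or.inl ⟨rfl, zu V hV e⟩
      · right
        rw [h] at hm
        obtain rfl := Option.some.inj hm
        refine ⟨(i, k), ?_⟩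
        rcases hp : R.P k j with _ | p
        · left
          rw [ht.mul_none hn hp] at e
          exact ⟨rfl, ⟨hD, hK⟩, zu V hV e⟩
        · right
          have htt := ht.mul hn hp
          rcases KM_class R C lab hlab hV with ⟨rfl, h'⟩ | ⟨i', k', x', mv, hD', hK', hx', h', ht'⟩
          · rw [h'] at e
            rw [← Option.some.inj e] at htt
            exact absurd rfl htt.ne
          · rw [h'] at e
            rw [← Option.some.inj e] at htt
            obtain ⟨rfl, rfl, rfl⟩ := htt.inj ht'
            have e1 : S.tgt x = S.src p := by
              obtain ⟨hv, -⟩ := ht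
              rw [R.P_src _ _ _ hp]; exact hv.2
            have e2 : S.tgt p = S.src y := by
              obtain ⟨hv, -⟩ := hn
              rw [R.P_tgt _ _ _ hp]; exact hv.1
            refine ⟨p, rfl, hD, hD', hK, hK', x, hx, ?_, ?_⟩
            · rw [S.src_mul _ _ e2, e1]
            · rw [hx', S.mul_assoc' _ _ _ e1 e2]
    · rintro (⟨rfl, rfl⟩ | ⟨⟨i, k⟩, ⟨hp, ⟨hD, hK⟩, rfl⟩ | ⟨p, hp, hD, hD', hK, hK', x, hx, hxt, hx'⟩⟩)
      · exact ⟨hz, hz, _, ez, by rw [mul0_zero_left, ez]⟩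
      · obtain ⟨x, m, a, b, d⟩ := DI_value R C lab hlab hD (C.K_path _ hK).2
        exact ⟨Or.inr ⟨_, hD, hK⟩, hz, m, b, by rw [d.mul_none hn hp, ez]⟩
      · obtain ⟨x1, m, a, b, d⟩ := DI_value R C lab hlab hD (C.K_path _ hK).2
        obtain ⟨x2, m', a', b', d'⟩ := DI_value R C lab hlab hD' (C.K_path _ hK').2
        rw [hx] at a
        obtain rfl := Option.some.inj a
        rw [hx'] at a'
        obtain rfl := Option.some.inj a'
        refine ⟨Or.inr ⟨(i, k), hD, hK⟩, Or.inr ⟨(i, μ), hD', hK'⟩, m, b, ?_⟩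
        rw [b']
        congr 1
        have e2 : S.tgt p = S.src y := by
          obtain ⟨hv, -⟩ := hn
          rw [R.P_tgt _ _ _ hp]; exact hv.1
        rw [S.src_mul _ _ e2] at hxt
        rw [← S.mul_assoc' _ _ _ hxt e2] at d'
        exact d'.ext (d.mul hn hp)

/-- Equality relation, between a language of representatives and another language of well-formed
words. -/
theorem eqv_finRes (R : Data0 S I Λ) (C : ChoiceOfReps S.toPreSgpd E) {c : ℕ} [Finite I] [Finite Λ]
    [Finite E]
    (lab : Ltr I Λ E c → Carrier0 S R) (hlab : ∀ e, Spec R C e (lab e))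
    (D : List (Ltr I Λ E c) → Prop) (K' : Set (List E)) (hD : FinRes1 D) (hDz : D [none])
    (hK' : ∀ u ∈ K', Ch C u)
    (hDc : ∀ V, D V → V = [none] ∨ ∃ i k, DI R C i k V ∧ V.flatMap dc ∈ K')
    (hR : FinRes (fun u v => u ∈ C.K ∧ v ∈ K' ∧
      evalPath? S.toPreSgpd C.lab u = evalPath? S.toPreSgpd C.lab v)) :
    FinRes (fun U V => KM R C c U ∧ D V ∧
      evalPath? (pre0 S R) lab U = evalPath? (pre0 S R) lab V) := by
  have hz : KM R C c [none] := Or.inl rfl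
  have ez : evalPath? (pre0 S R) lab [none] = some (zero0 S R) := by
    rw [eval_single, (hlab none).1 rfl]
  have hrel : FinRes (fun U V : List (Ltr I Λ E c) => (U = [none] ∧ V = [none]) ∨
        ∃ ik : I × Λ, DI R C ik.1 ik.2 U ∧ (DI R C ik.1 ik.2 V ∧ D V) ∧
            (U.flatMap dc ∈ C.K ∧ V.flatMap dc ∈ K' ∧
      evalPath? S.toPreSgpd C.lab (U.flatMap dc) = evalPath? S.toPreSgpd C.lab (V.flatMap dc))) := by
    refine FinRes.or (FinRes.rect (FinRes1.singleton none) (FinRes1.singleton none))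
        (FinRes.exists fun ik => ?_)
    exact FinRes.decode hR dc c (DI_finRes R C ik.1 ik.2)
      ((DI_finRes R C (c := c) ik.1 ik.2).and hD)
          (DI_hk R C (D1 := DI R C ik.1 ik.2) (D2 := fun V => DI R C ik.1 ik.2 V ∧ D V)
            (fun U h => h.2.1) (fun U h => h.1.2.1))
  convert hrel using 3 with U V
  constructor
  · rintro ⟨hU, hV, e⟩
    rcases KM_class R C lab hlab hU with ⟨rfl, h⟩ | ⟨i, k, x, m, hDU, hK, hx, h, ht⟩
    · rcases hDc V hV with rfl | ⟨i, k, hDV, hKV⟩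
      · exact Or.inl ⟨rfl, rfl⟩
      · obtain ⟨x2, m', a', b', d'⟩ := DI_value R C lab hlab hDV (hK' _ hKV)
        rw [h, b'] at e
        exact absurd (Option.some.inj e).symm d'.ne
    · rcases hDc V hV with rfl | ⟨i', k', hDV, hKV⟩
      · rw [h, ez] at e
        exact absurd (Option.some.inj e) ht.ne
      · obtain ⟨x2, m', a', b', d'⟩ := DI_value R C lab hlab hDV (hK' _ hKV)
        rw [h, b'] at e
        obtain rfl := Option.some.inj e
        obtain ⟨rfl, rfl, rfl⟩ := ht.inj d'
        exact Or.inr ⟨(i, k), hDU, ⟨hDV, hV⟩, hK, hKV, by rw [hx, a']⟩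
  · rintro (⟨rfl, rfl⟩ | ⟨⟨i, k⟩, hDU, ⟨hDV, hV⟩, hK, hKV, e⟩)
    · exact ⟨hz, hDz, rfl⟩
    · obtain ⟨x1, m, a, b, d⟩ := DI_value R C lab hlab hDU (C.K_path _ hK).2
      obtain ⟨x2, m', a', b', d'⟩ := DI_value R C lab hlab hDV (hK' _ hKV)
      rw [a, a'] at e
      obtain rfl := Option.some.inj e
      refine ⟨Or.inr ⟨(i, k), hDU, hK⟩, hV, ?_⟩
      rw [b, b', d.ext d']

theorem KM_ne {R : Data0 S I Λ} {C : ChoiceOfReps S.toPreSgpd E} {c : ℕ}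
    {U : List (Ltr I Λ E c)} (h : KM R C c U) : U ≠ [] := by
  rcases h with rfl | ⟨_, ⟨⟨e, he, -⟩, -⟩, -⟩
  · simp
  · rintro rfl; simp at he

theorem chain_unit {F : Type} (l : List F) :
    List.IsChain (fun _ _ : F => (() : Unit) = ()) l := by
  induction l with
  | nil => simp
  | cons a l ih =>
    cases l with
    | nil => simp
    | cons b l => exact List.isChain_cons_cons.2 ⟨rfl, ih⟩

theorem final (hiso : IsolationFree S.toPreSgpd)
    (R : Rees.Data0 S I Λ)
    (hfg : IsFG (Rees.pre0 S R))
    (hS : IsPrefixAutomatic S.toPreSgpd)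
    (hrig : Rees.WeaklyRIG0 S R { a : A | ¬ IsIdentity S.toPreSgpd a }) :
    IsPrefixAutomatic (Rees.pre0 S R) := by
  obtain ⟨hI, hL, hO⟩ := finite_idx hfg hiso
  obtain ⟨E, C, hC, hpre⟩ := hS
  have hE := hC.1
  obtain ⟨N, hN⟩ := exists_rep C hC.2.1
  have hBlk : Finite (Blk E (N + 1)) := (List.finite_length_le E (N + 1)).to_subtype
  choose lab hlab using fun e : Ltr I Λ E (N + 1) => exists_spec R C e
  let CM : ChoiceOfReps (pre0 S R) (Ltr I Λ E (N + 1)) :=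
    { esrc := fun _ => ()
      etgt := fun _ => ()
      lab := lab
      lab_src := fun _ => rfl
      lab_tgt := fun _ => rfl
      K := {U | KM R C (N + 1) U}
      K_path := fun l hl => ⟨KM_ne hl, chain_unit l⟩
      K_onto := by
        intro m
        rcases triple_or m with rfl | ⟨i, x, k, ht⟩
        · exact ⟨[none], Or.inl rfl, by rw [eval_single, (hlab none).1 rfl]⟩
        · obtain ⟨u, hu, hx, hwin⟩ := hN x
          have hcu : Ch C u := (C.K_path u hu).2
          obtain ⟨U, hD, rfl⟩ := DI_encode R C (c := N + 1) (Nat.succ_pos N) u.length u i k x le_rfl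
            hcu hx ht.1 (by
              intro u1 w u2 e hw y hy
              have hcw : Ch C w := by
                rw [e] at hcu
                exact hcu.left_of_append.right_of_append
              exact good_of_window C hrig N w hw hcw (hwin u1 w u2 e hw) hy)
          obtain ⟨x', m', a, b, d⟩ := DI_value R C lab hlab hD hcu
          rw [hx] at a
          obtain rfl := Option.some.inj a
          exact ⟨U, Or.inr ⟨(i, k), hD, hu⟩, by rw [b, d.ext ht]⟩ }
  have hKM := KM_finRes R C (N + 1) hC.2.1
  have hKMr : IsRegularSet CM.K := (finRes1_iff (KM R C (N + 1))).1 hKM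
  have hzp : [none] ∈ prefs CM.K := ⟨by simp, [none], Or.inl rfl, List.prefix_refl _⟩
  have hpp : FinRes1 (fun V => V ∈ prefs CM.K) := FinRes1.and FinRes1.nonnil (FinRes1.prefix hKM)
  refine ⟨_, CM, ⟨inferInstance, hKMr, ?_, ?_⟩, ?_⟩
  · intro a
    apply sync_of_finRes
    convert RM_finRes R C hC lab hlab (lab a) using 3 with U V
    simp only [relEdge, Set.mem_ofPred_eq]
    refine and_congr_right fun hU => and_congr_right fun hV => ?_
    obtain ⟨m, hm⟩ := eval_some (S := pre0 S R) lab (KM_ne hU)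
    have ht : pathTgt? CM.etgt U = some (CM.esrc a) := by
      obtain ⟨U', f, rfl⟩ := (List.eq_nil_or_concat' U).resolve_left (KM_ne hU)
      simp [pathTgt?]
    have hs : evalPath? (pre0 S R) CM.lab (U ++ [a]) = some (mul0 S R m (lab a)) :=
      eval_snoc lab a hm
    rw [hs]
    constructor
    · rintro ⟨-, h⟩
      exact ⟨m, hm, h.symm⟩
    · rintro ⟨m', h1, h2⟩
      rw [hm] at h1
      obtain rfl := Option.some.inj h1
      exact ⟨ht, h2.symm⟩
  · intro v
    apply sync_of_finRes
    convert eqv_finRes R C lab hlab (KM R C (N + 1)) C.K hKM (Or.inl rfl)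
      (fun u hu => (C.K_path u hu).2)
      (by
        intro V hV
        rcases hV with h | ⟨ik, h⟩
        · exact Or.inl h
        · exact Or.inr ⟨_, _, h⟩)
      (relEq_finRes C hC) using 3 with U V
    simp only [relVertex, Set.mem_ofPred_eq]
    refine and_congr_right fun hU => and_congr_right fun hV => ?_
    have ht : pathTgt? CM.etgt U = some v := by
      obtain ⟨U', f, rfl⟩ := (List.eq_nil_or_concat' U).resolve_left (KM_ne hU)
      simp [pathTgt?]
    exact ⟨fun h => h.2, fun h => ⟨ht, h⟩⟩
  · apply sync_of_finRes
    exact eqv_finRes R C lab hlab (fun V => V ∈ prefs CM.K) (prefs C.K) hpp hzp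
      (fun u hu => prefs_path C hu)
      (by
        rintro V ⟨hne, U, hU, hpr⟩
        exact KM_prefix R C hU hpr hne)
      (finRes_of_sync C.etgt hpre)

end Final
end Aux

/-- Theorem 5.2: a finitely generated Rees matrix semigroup with zero over a
prefix-automatic semigroupoid, whose non-identity arrows are weakly
right-ideal-generated by a row cross-section of `P`, is prefix-automatic. -/
theorem stmt_13 {O A I Λ : Type} (S : Sgpd O A) (hne : Nonempty A)
    (hiso : IsolationFree S.toPreSgpd)
    (R : Rees.Data0 S I Λ)
    (hfg : IsFG (Rees.pre0 S R))
    (hS : IsPrefixAutomatic S.toPreSgpd)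
    (hrig : Rees.WeaklyRIG0 S R { a : A | ¬ IsIdentity S.toPreSgpd a }) :
    IsPrefixAutomatic (Rees.pre0 S R) := by
  exact Aux.final hiso R hfg hS hrig

end AutoRees
end

section
/- Let M = M^0(S; F(I), G(Lambda); P) be a Rees matrix semigroup with zero over a semigroupoid S. If M is a prefix-automatic semigroup then S is a prefix-automatic semigroupoid. -/
/- Common framework: graphs, path languages, synchronous regularity,
   semigroupoids, automatic structures, and Rees matrix constructions. -/

namespace AutoRees

variable {O A E : Type} {S : PreSgpd O A}

/-! ### Finite-state recognisability -/

section Automata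

theorem rg_iff {α : Type} {L : Set (List α)} : IsRegularSet L ↔
    ∃ (σ : Type) (_ : Finite σ) (st : σ → α → σ) (q0 : σ) (acc : Set σ),
      ∀ x, x ∈ L ↔ x.foldl st q0 ∈ acc := by
  constructor
  · rintro ⟨σ, _, M, hM⟩
    refine ⟨σ, inferInstance, M.step, M.start, M.accept, fun x => ?_⟩
    have : x ∈ L ↔ x ∈ M.accepts := by rw [hM]; rfl
    rw [this]; rfl
  · rintro ⟨σ, _, st, q0, acc, h⟩
    refine ⟨σ, Fintype.ofFinite σ, ⟨st, q0, acc⟩, ?_⟩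
    ext x
    exact (h x).symm

theorem rg_inter {α : Type} {L L' : Set (List α)} (h : IsRegularSet L) (h' : IsRegularSet L') :
    IsRegularSet (L ∩ L') := Language.IsRegular.inf h h'

theorem rg_union {α : Type} {L L' : Set (List α)} (h : IsRegularSet L) (h' : IsRegularSet L') :
    IsRegularSet (L ∪ L') := Language.IsRegular.add h h'

theorem rg_empty {α : Type} : IsRegularSet (∅ : Set (List α)) :=
  rg_iff.2 ⟨Unit, inferInstance, fun _ _ => (), (), ∅, by simp⟩

theorem rg_univ {α : Type} : IsRegularSet (Set.univ : Set (List α)) :=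
  rg_iff.2 ⟨Unit, inferInstance, fun _ _ => (), (), Set.univ, by simp⟩

theorem rg_quot {α : Type} {L : Set (List α)} (h : IsRegularSet L) (B : Set (List α)) :
    IsRegularSet {x | ∃ y ∈ B, x ++ y ∈ L} := by
  obtain ⟨σ, _, st, q0, acc, h⟩ := rg_iff.1 h
  refine rg_iff.2 ⟨σ, inferInstance, st, q0, {q | ∃ y ∈ B, y.foldl st q ∈ acc}, fun x => ?_⟩
  simp [h]

theorem rg_comap {α β : Type} {L : Set (List β)} (h : IsRegularSet L) (f : α → β) :
    IsRegularSet {x | x.map f ∈ L} := by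
  obtain ⟨σ, _, st, q0, acc, h⟩ := rg_iff.1 h
  refine rg_iff.2 ⟨σ, inferInstance, fun q a => st q (f a), q0, acc, fun x => ?_⟩
  simp [h, List.foldl_map]

theorem rg_all {α : Type} (p : α → Prop) : IsRegularSet {x : List α | ∀ a ∈ x, p a} := by
  refine rg_iff.2 ⟨Prop, inferInstance, fun q a => q ∧ p a, True, {q | q}, fun x => ?_⟩
  have : ∀ (x : List α) (q : Prop), x.foldl (fun q a => q ∧ p a) q ↔ q ∧ ∀ a ∈ x, p a := by
    intro x
    induction x with
    | nil => simp
    | cons a x ih => intro q; simp [ih, and_assoc]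
  simp [this]

/-- Letter-to-letter sequential transduction. -/
def mealy {α β σ : Type} (δ : σ → α → σ) (out : σ → α → β) : σ → List α → List β
  | _, [] => []
  | s, a :: x => out s a :: mealy δ out (δ s a) x

theorem rg_mealy {α β τ : Type} [Finite τ] {L : Set (List α)} (h : IsRegularSet L)
    (δ : τ → α → τ) (out : τ → α → β) (s0 : τ) :
    IsRegularSet {y | ∃ x ∈ L, mealy δ out s0 x = y} := by
  obtain ⟨σ, _, st, q0, acc, h⟩ := rg_iff.1 h
  refine rg_iff.2 ⟨Set (σ × τ), inferInstance,
    fun Q b => {p | ∃ q ∈ Q, ∃ a, out q.2 a = b ∧ p = (st q.1 a, δ q.2 a)}, {(q0, s0)},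
    {Q | ∃ q ∈ Q, q.1 ∈ acc}, fun y => ?_⟩
  have key : ∀ (y : List β) (Q : Set (σ × τ)),
      (y.foldl (fun Q b => {p | ∃ q ∈ Q, ∃ a, out q.2 a = b ∧ p = (st q.1 a, δ q.2 a)}) Q ∈
        ({Q | ∃ q ∈ Q, q.1 ∈ acc} : Set (Set (σ × τ)))) ↔
      ∃ q ∈ Q, ∃ x : List α, mealy δ out q.2 x = y ∧ x.foldl st q.1 ∈ acc := by
    intro y
    induction y with
    | nil =>
      intro Q
      constructor
      · rintro ⟨q, hq, hacc⟩
        exact ⟨q, hq, [], rfl, hacc⟩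
      · rintro ⟨q, hq, x, hx, hacc⟩
        cases x with
        | nil => exact ⟨q, hq, hacc⟩
        | cons a x => simp [mealy] at hx
    | cons b y ih =>
      intro Q
      rw [List.foldl_cons, ih]
      constructor
      · rintro ⟨_, ⟨q, hq, a, hb, rfl⟩, x, hx, hacc⟩
        exact ⟨q, hq, a :: x, by simp [mealy, hb, hx], hacc⟩
      · rintro ⟨q, hq, x, hx, hacc⟩
        cases x with
        | nil => simp [mealy] at hx
        | cons a x =>
          simp only [mealy, List.cons.injEq] at hx
          exact ⟨_, ⟨q, hq, a, hx.1, rfl⟩, x, hx.2, hacc⟩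
  rw [key]
  constructor
  · rintro ⟨x, hx, rfl⟩
    exact ⟨_, rfl, x, rfl, (h x).1 hx⟩
  · rintro ⟨_, rfl, x, hx, hacc⟩
    exact ⟨x, (h x).2 hacc, hx⟩

/-- Padded convolution of a tuple of words, cut to length `N`. -/
def pad {ι E : Type} (t : ι → List E) : ℕ → List (ι → Option E)
  | 0 => []
  | N + 1 => (fun i => (t i).head?) :: pad (fun i => (t i).tail) N

theorem pad_length {ι E : Type} (t : ι → List E) (N : ℕ) : (pad t N).length = N := by
  induction N generalizing t with
  | zero => rfl
  | succ N ih => simp [pad, ih]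

theorem pad_inj {ι E : Type} (t t' : ι → List E) (N : ℕ) (h : ∀ i, (t i).length ≤ N)
    (h' : ∀ i, (t' i).length ≤ N) (he : pad t N = pad t' N) : t = t' := by
  induction N generalizing t t' with
  | zero =>
    funext i
    have := h i; have := h' i
    simp_all
  | succ N ih =>
    simp only [pad, List.cons.injEq] at he
    have := ih _ _ (fun i => by have := h i; simp; omega) (fun i => by have := h' i; simp; omega) he.2
    funext i
    have h1 := congrFun he.1 i
    have h2 := congrFun this i
    cases hi : t i <;> cases hi' : t' i <;> simp_all

theorem pad_map {ι κ E : Type} (g : κ → ι) (t : ι → List E) (N : ℕ) :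
    (pad t N).map (fun a => a ∘ g) = pad (t ∘ g) N := by
  induction N generalizing t with
  | zero => rfl
  | succ N ih => simp only [pad, List.map_cons, ih]; rfl

theorem pad_blank {ι E : Type} (N : ℕ) :
    pad (fun _ : ι => ([] : List E)) N = List.replicate N (fun _ => none) := by
  induction N with
  | zero => rfl
  | succ N ih => simp [pad, ih, List.replicate_succ]

theorem pad_add {ι E : Type} (t : ι → List E) (N k : ℕ) (h : ∀ i, (t i).length ≤ N) :
    pad t (N + k) = pad t N ++ List.replicate k (fun _ => none) := by
  induction N generalizing t with
  | zero =>
    have : t = fun _ => [] := by funext i; have := h i; simpa using this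
    subst this
    simp [pad, pad_blank]
  | succ N ih =>
    rw [Nat.add_right_comm]
    simp only [pad, List.cons_append, List.cons.injEq, true_and]
    exact ih _ (fun i => by have := h i; simp; omega)

theorem valid_regular (ι E : Type) [Finite ι] :
    IsRegularSet {x : List (ι → Option E) |
      ∃ t N, (∀ i, (t i).length ≤ N) ∧ pad t N = x} := by
  classical
  have := rg_mealy (τ := ι → Bool) (rg_univ (α := ι → Option E))
    (fun s a i => s i || (a i).isNone) (fun s a i => if s i then none else a i) (fun _ => false)
  convert this using 1
  ext y
  simp only [Set.mem_ofPred_eq, Set.mem_univ, true_and]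
  constructor
  · rintro ⟨t, N, h, rfl⟩
    refine ⟨pad t N, ?_⟩
    have : ∀ (N : ℕ) (t : ι → List E) (s : ι → Bool), (∀ i, s i = true → t i = []) →
        mealy (fun s a i => s i || (a i).isNone) (fun s a i => if s i then none else a i) s
          (pad t N) = pad t N := by
      intro N
      induction N with
      | zero => intros; rfl
      | succ N ih =>
        intro t s hs
        simp only [pad, mealy, List.cons.injEq]
        refine ⟨?_, ih _ _ ?_⟩
        · funext i
          cases hi : s i with
          | false => simp
          | true => simp [hs i hi]
        · intro i hi
          cases hi' : s i with
          | true => simp [hs i hi']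
          | false => 
            simp [hi'] at hi
            simp [hi]
    exact this N t _ (by simp)
  · rintro ⟨x, rfl⟩
    have : ∀ (x : List (ι → Option E)) (s : ι → Bool), ∃ t : ι → List E,
        (∀ i, s i = true → t i = []) ∧ (∀ i, (t i).length ≤ x.length) ∧
        pad t x.length = 
        mealy (fun s a i => s i || (a i).isNone) (fun s a i => if s i then none else a i) s x := by
      intro x
      induction x with
      | nil => intro s; exact ⟨fun _ => [], by simp, by simp, rfl⟩
      | cons a x ih =>
        intro s
        obtain ⟨t, h1, h2, h3⟩ := ih (fun i => s i || (a i).isNone)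
        refine ⟨fun i => if s i then [] else match a i with
          | none => []
          | some e => e :: t i, ?_, ?_, ?_⟩
        · intro i hi; simp [hi]
        · intro i
          have := h2 i
          dsimp only
          split_ifs
          · simp
          · cases a i <;> simp [this]
        · simp only [List.length_cons, pad, mealy, List.cons.injEq]
          constructor
          · funext i
            split_ifs
            · rfl
            · cases a i <;> simp
          · rw [← h3]
            congr 1
            funext i
            have := h1 i
            cases hs : s i <;> cases ha : a i <;> simp_all
    obtain ⟨t, -, h2, h3⟩ := this x (fun _ => false)
    exact ⟨t, _, h2, h3⟩

/-- Synchronous recognisability of a relation on tuples of words. -/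
def Rec {ι E : Type} (R : Set (ι → List E)) : Prop :=
  ∃ L : Set (List (ι → Option E)), IsRegularSet L ∧
    ∀ t N, (∀ i, (t i).length ≤ N) → (pad t N ∈ L ↔ t ∈ R)

theorem Rec.inter {ι E : Type} {R R' : Set (ι → List E)} (h : Rec R) (h' : Rec R') :
    Rec (R ∩ R') := by
  obtain ⟨L, hL, h⟩ := h
  obtain ⟨L', hL', h'⟩ := h'
  exact ⟨_, rg_inter hL hL', fun t N ht => and_congr (h t N ht) (h' t N ht)⟩

theorem Rec.union {ι E : Type} {R R' : Set (ι → List E)} (h : Rec R) (h' : Rec R') :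
    Rec (R ∪ R') := by
  obtain ⟨L, hL, h⟩ := h
  obtain ⟨L', hL', h'⟩ := h'
  exact ⟨_, rg_union hL hL', fun t N ht => or_congr (h t N ht) (h' t N ht)⟩

theorem Rec.empty {ι E : Type} : Rec (∅ : Set (ι → List E)) :=
  ⟨∅, rg_empty, fun _ _ _ => Iff.rfl⟩

theorem Rec.comap {ι κ E : Type} {R : Set (κ → List E)} (h : Rec R) (g : κ → ι) :
    Rec {t : ι → List E | t ∘ g ∈ R} := by
  obtain ⟨L, hL, h⟩ := h
  refine ⟨_, rg_comap hL (fun a => a ∘ g), fun t N ht => ?_⟩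
  simp only [Set.mem_ofPred_eq]
  rw [pad_map]
  exact h _ _ (fun i => ht _)

theorem Rec.map {ι κ E : Type} [Finite ι] {R : Set (ι → List E)} (h : Rec R) (g : κ → ι) :
    Rec {t : κ → List E | ∃ t' ∈ R, t' ∘ g = t} := by
  obtain ⟨L, hL, h⟩ := h
  refine ⟨_, rg_quot (rg_mealy (τ := Unit) (rg_inter hL (valid_regular ι E)) (fun _ _ => ())
    (fun _ a => a ∘ g) ()) {y | ∃ k, y = List.replicate k (fun _ => none)}, fun t N ht => ?_⟩
  have hm : ∀ x : List (ι → Option E), mealy (fun _ _ => ()) (fun _ a => a ∘ g) () x =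
      x.map (fun a => a ∘ g) := by
    intro x
    induction x with
    | nil => rfl
    | cons a x ih => simp [mealy, ih]
  simp only [Set.mem_ofPred_eq, hm]
  constructor
  · rintro ⟨_, ⟨k, rfl⟩, x, ⟨hx, t', N', ht', rfl⟩, he⟩
    rw [pad_map, ← pad_add _ _ _ ht] at he
    have hN : N' = N + k := by simpa [pad_length] using congrArg List.length he
    subst hN
    exact ⟨t', (h _ _ ht').1 hx, pad_inj _ _ _ (fun i => ht' _)
      (fun i => (ht i).trans (Nat.le_add_right _ _)) he⟩
  · rintro ⟨t', ht', rfl⟩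
    have := Fintype.ofFinite ι
    let N' := ∑ i, (t' i).length
    have hN' : ∀ i, (t' i).length ≤ N + N' := fun i =>
      (Finset.single_le_sum (f := fun i => (t' i).length) (fun _ _ => Nat.zero_le _)
        (Finset.mem_univ i)).trans (Nat.le_add_left _ _)
    refine ⟨_, ⟨N', rfl⟩, pad t' (N + N'), ⟨(h _ _ hN').2 ht', t', _, hN', rfl⟩, ?_⟩
    rw [pad_map, pad_add _ _ _ ht]

theorem Rec.lang {ι E : Type} {L : Set (List E)} (h : IsRegularSet L) (i : ι) :
    Rec {t : ι → List E | t i ∈ L} := by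
  obtain ⟨σ, _, st, q0, acc, h⟩ := rg_iff.1 h
  have hf : ∀ (N : ℕ) (t : ι → List E) (q : σ), (∀ i, (t i).length ≤ N) →
      (pad t N).foldl (fun q a => (a i).elim q (st q)) q = (t i).foldl st q := by
    intro N
    induction N with
    | zero =>
      intro t q ht
      have := ht i
      have : t i = [] := by simpa using this
      simp [this, pad]
    | succ N ih =>
      intro t q ht
      simp only [pad, List.foldl_cons]
      rw [ih _ _ (fun i => by have := ht i; simp; omega)]
      cases t i <;> simp
  refine ⟨{x | x.foldl (fun q a => (a i).elim q (st q)) q0 ∈ acc},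
    rg_iff.2 ⟨σ, inferInstance, _, q0, acc, fun x => Iff.rfl⟩, fun t N ht => ?_⟩
  simp only [Set.mem_ofPred_eq, h, hf N t q0 ht]

/-- Binary version. -/
def Rec2 {E : Type} (R : List E → List E → Prop) : Prop :=
  Rec {t : Fin 2 → List E | R (t 0) (t 1)}

variable {E : Type}

theorem Rec2.and {R R' : List E → List E → Prop} (h : Rec2 R) (h' : Rec2 R') :
    Rec2 (fun u v => R u v ∧ R' u v) := Rec.inter h h'

theorem Rec2.or {R R' : List E → List E → Prop} (h : Rec2 R) (h' : Rec2 R') :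
    Rec2 (fun u v => R u v ∨ R' u v) := Rec.union h h'

theorem Rec2.left {L : Set (List E)} (h : IsRegularSet L) : Rec2 (fun u _ : List E => u ∈ L) :=
  Rec.lang h 0

theorem Rec2.right {L : Set (List E)} (h : IsRegularSet L) : Rec2 (fun _ v : List E => v ∈ L) :=
  Rec.lang h 1

theorem Rec2.symm {R : List E → List E → Prop} (h : Rec2 R) : Rec2 (fun u v => R v u) :=
  Rec.comap h ![1, 0]

theorem Rec2.congr {R R' : List E → List E → Prop} (h : Rec2 R) (he : ∀ u v, R' u v ↔ R u v) :
    Rec2 R' := by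
  have : R' = R := by funext u v; exact propext (he u v)
  rwa [this]

theorem Rec2.comp {R R' : List E → List E → Prop} (h : Rec2 R) (h' : Rec2 R') :
    Rec2 (fun u v => ∃ w, R u w ∧ R' w v) := by
  have h1 : Rec {t : Fin 3 → List E | R (t 0) (t 1)} := Rec.comap h ![0, 1]
  have h2 : Rec {t : Fin 3 → List E | R' (t 1) (t 2)} := Rec.comap h' ![1, 2]
  have h3 := (h1.inter h2).map ![(0 : Fin 3), 2]
  unfold Rec2
  convert h3 using 1
  ext t
  constructor
  · rintro ⟨w, h, h'⟩
    refine ⟨![t 0, w, t 1], ⟨h, h'⟩, ?_⟩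
    funext i
    fin_cases i <;> rfl
  · rintro ⟨t', ⟨h, h'⟩, rfl⟩
    exact ⟨t' 1, h, h'⟩

theorem Rec2.exists_fin {γ : Type} [Finite γ] {R : γ → List E → List E → Prop}
    (h : ∀ g, Rec2 (R g)) : Rec2 (fun u v => ∃ g, R g u v) := by
  have := Fintype.ofFinite γ
  classical
  have key : ∀ s : Finset γ, Rec2 (fun u v => ∃ g ∈ s, R g u v) := by
    intro s
    induction s using Finset.induction_on with
    | empty =>
      refine Rec2.congr (R := fun _ _ => False) Rec.empty ?_
      simp
    | insert a s _ ih =>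
      refine ((h a).or ih).congr ?_
      simp
  exact (key Finset.univ).congr (by simp)

/-- The relation of appending one letter is recognisable. -/
theorem Rec2.snoc (g : E) : Rec2 (fun u v => v = u ++ [g]) := by
  classical
  let st : Option Bool → (Fin 2 → Option E) → Option Bool := fun q a =>
    match q with
    | none => none
    | some false => if a 0 = none then (if a 1 = some g then some true else none)
        else (if a 0 = a 1 then some false else none)
    | some true => if a 0 = none ∧ a 1 = none then some true else none
  have hn : ∀ (x : List (Fin 2 → Option E)), x.foldl st none = none := by
    intro x; induction x with
    | nil => rfl
    | cons a x ih => simpa [st] using ih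
  have ht : ∀ (N : ℕ) (t : Fin 2 → List E), (∀ i, (t i).length ≤ N) →
      ((pad t N).foldl st (some true) = some true ↔ t 0 = [] ∧ t 1 = []) := by
    intro N
    induction N with
    | zero =>
      intro t h
      have h0 := h 0; have h1 := h 1
      simp at h0 h1
      simp [pad, h0, h1]
    | succ N ih =>
      intro t h
      have ih' := ih (fun i => (t i).tail) (fun i => by have := h i; simp; omega)
      simp only [pad, List.foldl_cons]
      cases h0 : t 0 <;> cases h1 : t 1 <;> simp_all [st]
  have hf : ∀ (N : ℕ) (t : Fin 2 → List E), (∀ i, (t i).length ≤ N) →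
      ((pad t N).foldl st (some false) = some true ↔ t 1 = t 0 ++ [g]) := by
    intro N
    induction N with
    | zero =>
      intro t h
      have h0 := h 0; have h1 := h 1
      simp at h0 h1
      simp [pad, h0, h1]
    | succ N ih =>
      intro t h
      have ih' := ih (fun i => (t i).tail) (fun i => by have := h i; simp; omega)
      have ht' := ht N (fun i => (t i).tail) (fun i => by have := h i; simp; omega)
      simp only [pad, List.foldl_cons]
      cases h0 : t 0 with
      | nil =>
        cases h1 : t 1 with
        | nil => simp [st, h0, h1, hn]
        | cons b v =>
          by_cases hb : b = g
          · simp_all [st]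
          · simp [st, h0, h1, hn, hb]
      | cons a u =>
        cases h1 : t 1 with
        | nil => simp [st, h0, h1, hn]
        | cons b v =>
          by_cases hb : a = b
          · simp_all [st]
          · simp [st, h0, h1, hn, hb, eq_comm]
  refine ⟨{x | x.foldl st (some false) = some true}, rg_iff.2 ⟨Option Bool, inferInstance, st, _,
    {some true}, fun x => Iff.rfl⟩, fun t N h => hf N t h⟩

theorem Rec2.eq_nil : IsRegularSet {x : List E | x = []} := by
  refine rg_iff.2 ⟨Bool, inferInstance, fun _ _ => false, true, {true}, fun x => ?_⟩
  have : ∀ x : List E, x.foldl (fun _ _ => false) false = false := by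
    intro x; induction x with
    | nil => rfl
    | cons a x ih => simpa using ih
  cases x with
  | nil => simp
  | cons a x => simp [this]

theorem Rec2.ne_nil : IsRegularSet {x : List E | x ≠ []} :=
  Language.IsRegular.compl Rec2.eq_nil

theorem Rec2.right_eq (w : List E) : Rec2 (fun _ v : List E => v = w) := by
  induction w using List.reverseRecOn with
  | nil => exact Rec2.right Rec2.eq_nil
  | append_singleton w g ih =>
    refine (ih.comp (Rec2.snoc g)).congr ?_
    simp

end Automata

section Bridge

/-- `deltaPair` with prescribed padding symbols. -/
def dpair {V E : Type} (p q : E ⊕ Option V) (a b : List E) :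
    List ((E ⊕ Option V) × (E ⊕ Option V)) :=
  (a.map Sum.inl).zip (b.map Sum.inl) ++
    (if a.length ≤ b.length
      then (b.drop a.length).map (fun e => (p, Sum.inl e))
      else (a.drop b.length).map (fun e => (Sum.inl e, q)))

variable {V E : Type} (p q : E ⊕ Option V)

theorem dpair_nil_nil : dpair p q [] [] = [] := rfl

theorem dpair_cons_nil (a : E) (u : List E) :
    dpair p q (a :: u) [] = (Sum.inl a, q) :: dpair p q u [] := by
  cases u <;> simp [dpair]

theorem dpair_nil_cons (b : E) (v : List E) :
    dpair p q [] (b :: v) = (p, Sum.inl b) :: dpair p q [] v := by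
  simp [dpair]

theorem dpair_cons_cons (a b : E) (u v : List E) :
    dpair p q (a :: u) (b :: v) = (Sum.inl a, Sum.inl b) :: dpair p q u v := by
  simp [dpair]

theorem dpair_fst (o o' : Option V) (u v : List E) :
    (dpair (Sum.inr o) (Sum.inr o') u v).filterMap (fun x => x.1.getLeft?) = u ∧
    (dpair (Sum.inr o) (Sum.inr o') u v).filterMap (fun x => x.2.getLeft?) = v := by
  induction u generalizing v with
  | nil =>
    induction v with
    | nil => simp [dpair_nil_nil]
    | cons b v ih => simpa [dpair_nil_cons, List.filterMap_cons, -List.filterMap_eq_nil_iff] using ih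
  | cons a u ih =>
    cases v with
    | nil => simpa [dpair_cons_nil, List.filterMap_cons, -List.filterMap_eq_nil_iff] using ih []
    | cons b v => simp [dpair_cons_cons, ih]

theorem deltaPair_inj {etgt : E → V} {u v u' v' : List E}
    (h : deltaPair etgt u v = deltaPair etgt u' v') : u = u' ∧ v = v' := by
  have h1 := dpair_fst (u.getLast?.map etgt) (v.getLast?.map etgt) u v
  have h2 := dpair_fst (u'.getLast?.map etgt) (v'.getLast?.map etgt) u' v'
  have h' : dpair (Sum.inr (u.getLast?.map etgt)) (Sum.inr (v.getLast?.map etgt)) u v =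
    dpair (Sum.inr (u'.getLast?.map etgt)) (Sum.inr (v'.getLast?.map etgt)) u' v' := h
  rw [h'] at h1
  exact ⟨h1.1.symm.trans h2.1, h1.2.symm.trans h2.2⟩

theorem rec2_of_syncRegular {etgt : E → Unit} {R : Set (List E × List E)}
    (hR : ∀ r ∈ R, r.1 ≠ [] ∧ r.2 ≠ []) (h : SyncRegular etgt R) :
    Rec2 (fun u v => (u, v) ∈ R) := by
  obtain ⟨σ, _, st, q0, acc, h⟩ := rg_iff.1 h
  classical
  let psi : Option E → E ⊕ Option Unit := fun a => a.elim (Sum.inr (some ())) Sum.inl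
  let st' : σ → (Fin 2 → Option E) → σ := fun q a =>
    if a 0 = none ∧ a 1 = none then q else st q (psi (a 0), psi (a 1))
  have hf : ∀ (N : ℕ) (t : Fin 2 → List E) (q : σ), (∀ i, (t i).length ≤ N) →
      (pad t N).foldl st' q =
        (dpair (Sum.inr (some ())) (Sum.inr (some ())) (t 0) (t 1)).foldl st q := by
    intro N
    induction N with
    | zero =>
      intro t q h
      have h0 := h 0; have h1 := h 1
      simp at h0 h1
      simp [pad, h0, h1, dpair_nil_nil]
    | succ N ih =>
      intro t q h
      simp only [pad, List.foldl_cons]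
      rw [ih _ _ (fun i => by have := h i; simp; omega)]
      cases h0 : t 0 <;> cases h1 : t 1 <;>
        simp [st', psi, dpair_nil_nil, dpair_cons_nil, dpair_nil_cons, dpair_cons_cons, h0, h1]
  have h1 : Rec2 (fun u v : List E => (u ≠ [] ∧ v ≠ []) ∧
      deltaPair etgt u v ∈ {w | ∃ p ∈ R, w = deltaPair etgt p.1 p.2}) := by
    have hn : Rec2 (fun u v : List E => u ≠ [] ∧ v ≠ []) :=
      Rec2.and (Rec2.left Rec2.ne_nil) (Rec2.right Rec2.ne_nil)
    obtain ⟨L, hL, hn⟩ := hn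
    refine ⟨L ∩ {x | x.foldl st' q0 ∈ acc}, rg_inter hL (rg_iff.2 ⟨σ, inferInstance, st', q0, acc,
      fun x => Iff.rfl⟩), fun t N ht => ?_⟩
    refine and_congr_right_iff.2 ?_ |>.trans (and_congr_left_iff.2 fun _ => hn t N ht)
    intro hx
    have hx := (hn t N ht).1 hx
    simp only [Set.mem_ofPred_eq, hf N t q0 ht]
    rw [← Set.mem_ofPred_eq (p := fun w => ∃ p ∈ R, w = deltaPair etgt p.1 p.2), h]
    have e0 : (Sum.inr (some ()) : E ⊕ Option Unit) = padSym etgt (t 0) := by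
      simp [padSym, List.getLast?_eq_some_getLast hx.1]
    have e1 : (Sum.inr (some ()) : E ⊕ Option Unit) = padSym etgt (t 1) := by
      simp [padSym, List.getLast?_eq_some_getLast hx.2]
    have : dpair (Sum.inr (some ())) (Sum.inr (some ())) (t 0) (t 1) =
        deltaPair etgt (t 0) (t 1) := by
      conv_lhs => arg 1; rw [e0]
      conv_lhs => arg 2; rw [e1]
      rfl
    rw [this]
  refine h1.congr fun u v => ?_
  constructor
  · intro h; exact ⟨hR _ h, _, h, rfl⟩
  · rintro ⟨-, ⟨u', v'⟩, hp, he⟩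
    obtain ⟨rfl, rfl⟩ := deltaPair_inj he
    exact hp

/-! The encoding of words: remember the previous letter. -/

def encFrom : Option (Option E × E) → List E → List (Option E × E)
  | _, [] => []
  | s, e :: l => (s.map Prod.snd, e) :: encFrom (some (s.map Prod.snd, e)) l

def enc (l : List E) : List (Option E × E) := encFrom none l

def lastOf : Option (Option E × E) → List E → Option (Option E × E)
  | s, [] => s
  | s, e :: l => lastOf (some (s.map Prod.snd, e)) l

theorem lastOf_eq (s : Option (Option E × E)) (l : List E) :
    lastOf s l = ((encFrom s l).getLast?).or s := by
  induction l generalizing s with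
  | nil => simp [lastOf, encFrom]
  | cons e l ih => 
    rw [lastOf, ih, encFrom, List.getLast?_cons]
    cases (encFrom (some (s.map Prod.snd, e)) l).getLast? <;> simp

theorem lastOf_none (l : List E) : lastOf none l = (enc l).getLast? := by
  rw [lastOf_eq]; simp [enc]

def trOut (etgt : Option E × E → V) (s : Option (Option E × E)) (a : Option E) :
    (Option E × E) ⊕ Option V :=
  a.elim (Sum.inr (s.map etgt)) (fun e => Sum.inl (s.map Prod.snd, e))

def trNext (s : Option (Option E × E)) (a : Option E) : Option (Option E × E) :=
  a.elim s (fun e => some (s.map Prod.snd, e))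

theorem mealy_pad (etgt : Option E × E → V) (N : ℕ) (t : Fin 2 → List E)
    (s : Fin 2 → Option (Option E × E)) (h : ∀ i, (t i).length ≤ N)
    (hN : N ≤ max (t 0).length (t 1).length) :
    mealy (fun s a i => trNext (s i) (a i))
      (fun s a => (trOut etgt (s 0) (a 0), trOut etgt (s 1) (a 1))) s (pad t N) =
    dpair (Sum.inr ((lastOf (s 0) (t 0)).map etgt)) (Sum.inr ((lastOf (s 1) (t 1)).map etgt))
      (encFrom (s 0) (t 0)) (encFrom (s 1) (t 1)) := by
  induction N generalizing t s with
  | zero =>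
    have h0 := h 0; have h1 := h 1
    simp at h0 h1
    simp [pad, h0, h1, mealy, encFrom, dpair_nil_nil]
  | succ N ih =>
    simp only [pad, mealy]
    rw [ih _ _ (fun i => by have := h i; simp; omega) (by simp; omega)]
    cases h0 : t 0 <;> cases h1 : t 1
    · simp [h0, h1] at hN
    all_goals
      simp [trNext, trOut, encFrom, lastOf, dpair_cons_nil, dpair_nil_cons, dpair_cons_cons]

theorem syncRegular_of_rec2 [Finite E] (etgt : Option E × E → V) {R : List E → List E → Prop}
    (h : Rec2 R) :
    SyncRegular etgt {r | ∃ u v, R u v ∧ r = (enc u, enc v)} := by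
  obtain ⟨L, hL, h⟩ := h
  have h1 := rg_mealy (rg_inter (rg_inter hL (valid_regular (Fin 2) E))
    (rg_all (fun a : Fin 2 → Option E => a ≠ fun _ => none)))
    (fun (s : Fin 2 → Option (Option E × E)) a i => trNext (s i) (a i))
    (fun s a => (trOut etgt (s 0) (a 0), trOut etgt (s 1) (a 1))) (fun _ => none)
  unfold SyncRegular
  convert h1 using 1
  have hk : ∀ u v : List E, mealy (fun (s : Fin 2 → Option (Option E × E)) a i => trNext (s i) (a i))
      (fun s a => (trOut etgt (s 0) (a 0), trOut etgt (s 1) (a 1))) (fun _ => none)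
      (pad ![u, v] (max u.length v.length)) = deltaPair etgt (enc u) (enc v) := by
    intro u v
    rw [mealy_pad etgt _ _ _ (by intro i; fin_cases i <;> simp) (by simp)]
    simp only [lastOf_none]
    rfl
  have hnb : ∀ (N : ℕ) (t : Fin 2 → List E), (∀ i, (t i).length ≤ N) →
      ((∀ a ∈ pad t N, a ≠ fun _ => none) ↔ N ≤ max (t 0).length (t 1).length) := by
    intro N
    induction N with
    | zero => intro t h; simp [pad]
    | succ N ih =>
      intro t h
      simp only [pad, List.forall_mem_cons]
      rw [ih _ (fun i => by have := h i; simp; omega)]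
      have : (fun i => (t i).head?) ≠ (fun _ => none) ↔ (t 0 ≠ [] ∨ t 1 ≠ []) := by
        rw [Ne, funext_iff, Fin.forall_fin_two]
        simp [imp_iff_not_or]
      rw [this]
      cases h0 : t 0 <;> cases h1 : t 1 <;> simp
  ext w
  constructor
  · rintro ⟨_, ⟨u, v, hR, rfl⟩, rfl⟩
    have hl : ∀ i, ((![u, v] : Fin 2 → List E) i).length ≤ max u.length v.length := by
      intro i; fin_cases i <;> simp
    refine ⟨pad ![u, v] (max u.length v.length), ⟨⟨(h _ _ hl).2 hR, _, _, hl, rfl⟩, ?_⟩, hk u v⟩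
    exact (hnb _ _ hl).2 (by simp)
  · rintro ⟨_, ⟨⟨hx, t, N, hl, rfl⟩, hb⟩, rfl⟩
    have hN := (hnb _ _ hl).1 hb
    have : N = max (t 0).length (t 1).length := le_antisymm hN (max_le (hl 0) (hl 1))
    have ht : t = ![t 0, t 1] := by funext i; fin_cases i <;> rfl
    refine ⟨_, ⟨t 0, t 1, (h _ _ hl).1 hx, rfl⟩, ?_⟩
    rw [← hk, ← ht, this]

theorem enc_regular [Finite E] {L : Set (List E)} (h : IsRegularSet L) :
    IsRegularSet {y | ∃ x ∈ L, enc x = y} := by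
  have h1 := rg_mealy h (fun (s : Option (Option E × E)) (e : E) => some (s.map Prod.snd, e))
    (fun s e => (s.map Prod.snd, e)) none
  have : ∀ (x : List E) s, mealy (fun (s : Option (Option E × E)) (e : E) => some (s.map Prod.snd, e))
    (fun s e => (s.map Prod.snd, e)) s x = encFrom s x := by
    intro x
    induction x with
    | nil => intro s; rfl
    | cons e x ih => intro s; simp [mealy, encFrom, ih]
  simp only [this] at h1
  exact h1

theorem encFrom_take (s : Option (Option E × E)) (l : List E) (n : ℕ) :
    encFrom s (l.take n) = (encFrom s l).take n := by
  induction l generalizing s n with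
  | nil => simp [encFrom]
  | cons e l ih => cases n <;> simp [encFrom, ih]

theorem enc_append_singleton (l : List E) (e : E) :
    enc (l ++ [e]) = enc l ++ [(l.getLast?, e)] := by
  have : ∀ (l : List E) (s : Option (Option E × E)),
      encFrom s (l ++ [e]) = encFrom s l ++ [(l.getLast?.or (s.map Prod.snd), e)] := by
    intro l
    induction l with
    | nil => intro s; simp [encFrom]
    | cons a l ih =>
      intro s
      simp only [List.cons_append, encFrom, ih, List.getLast?_cons]
      cases l.getLast? <;> simp
  simpa [enc] using this l none

theorem enc_eq_nil {l : List E} : enc l = [] ↔ l = [] := by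
  cases l <;> simp [enc, encFrom]

theorem enc_prefs (K : Set (List E)) (y : List (Option E × E)) :
    y ∈ prefs {y | ∃ x ∈ K, enc x = y} ↔ ∃ x ∈ prefs K, enc x = y := by
  constructor
  · rintro ⟨hy, _, ⟨x, hx, rfl⟩, hp⟩
    have := List.prefix_iff_eq_take.1 hp
    rw [enc, ← encFrom_take] at this
    refine ⟨x.take y.length, ⟨?_, x, hx, List.take_prefix _ _⟩, this.symm⟩
    intro h
    rw [h] at this
    exact hy this
  · rintro ⟨x, ⟨hx, l, hl, hp⟩, rfl⟩
    refine ⟨fun h => hx (enc_eq_nil.1 h), _, ⟨l, hl, rfl⟩, ?_⟩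
    have := List.prefix_iff_eq_take.1 hp
    rw [this]
    show encFrom _ _ <+: _
    rw [encFrom_take]
    exact List.take_prefix _ _

theorem prefs_regular {K : Set (List E)} (h : IsRegularSet K) : IsRegularSet (prefs K) := by
  have h1 := rg_inter (Rec2.ne_nil (E := E)) (rg_quot h Set.univ)
  convert h1 using 1
  ext x
  constructor
  · rintro ⟨hx, l, hl, y, rfl⟩
    exact ⟨hx, y, trivial, hl⟩
  · rintro ⟨hx, y, -, hl⟩
    exact ⟨hx, _, hl, y, rfl⟩

end Bridge

section Eval

variable {O A E : Type} (S : PreSgpd O A) (lab : E → A)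

/-- Right multiplication, with `none` as an adjoined identity. -/
def mulO (o : Option A) (m : A) : Option A := some (o.elim m (fun a => S.mul a m))

theorem evalPath_snoc (l : List E) (e : E) :
    evalPath? S lab (l ++ [e]) = mulO S (evalPath? S lab l) (lab e) := by
  cases l <;> simp [evalPath?, mulO]

theorem evalPath_append_congr {u u' : List E} (h : evalPath? S lab u = evalPath? S lab u')
    (w : List E) : evalPath? S lab (u ++ w) = evalPath? S lab (u' ++ w) := by
  induction w using List.reverseRecOn with
  | nil => simpa using h
  | append_singleton w e ih => 
    rw [← List.append_assoc, ← List.append_assoc, evalPath_snoc, evalPath_snoc, ih]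

theorem evalPath_append (hassoc : ∀ a b c, S.mul (S.mul a b) c = S.mul a (S.mul b c))
    (u w : List E) (m : A) (h : evalPath? S lab w = some m) :
    evalPath? S lab (u ++ w) = mulO S (evalPath? S lab u) m := by
  induction w using List.reverseRecOn generalizing m with
  | nil => simp [evalPath?] at h
  | append_singleton w e ih =>
    rw [← List.append_assoc, evalPath_snoc]
    rw [evalPath_snoc] at h
    cases hw : evalPath? S lab w with
    | none =>
      have : w = [] := by cases w <;> simp_all [evalPath?]
      subst this
      simp [mulO, evalPath?] at h
      simp [h]
    | some a =>
      rw [ih a hw]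
      simp only [hw, mulO, Option.elim, Option.some.injEq] at h
      subst h
      cases evalPath? S lab u <;> simp [mulO, hassoc]

theorem evalPath_some {l : List E} (h : l ≠ []) : ∃ a, evalPath? S lab l = some a := by
  cases l with
  | nil => exact absurd rfl h
  | cons a l => exact ⟨_, rfl⟩

end Eval

namespace Rees

variable {O A I Λ : Type} {S : Sgpd O A} (R : Data0 S I Λ)

/-- The underlying triple. -/
def val : Carrier0 S R → Option (I × A × Λ)
  | none => none
  | some t => some t.1

theorem val_inj {a b : Carrier0 S R} (h : val R a = val R b) : a = b := by
  rcases a with _ | ⟨a, ha⟩ <;> rcases b with _ | ⟨b, hb⟩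
  · rfl
  · exact absurd h (by simp [val])
  · exact absurd h (by simp [val])
  · simp only [val, Option.some.injEq] at h
    subst h
    rfl

theorem val_valid {a : Carrier0 S R} {i x l} (h : val R a = some (i, x, l)) :
    R.F i = S.src x ∧ S.tgt x = R.G l := by
  cases a with
  | none => simp [val] at h
  | some t =>
    obtain ⟨t, ht⟩ := t
    simp only [val, Option.some.injEq] at h
    subst h
    exact ht

theorem exists_val {i x l} (h1 : R.F i = S.src x) (h2 : S.tgt x = R.G l) :
    ∃ a : Carrier0 S R, val R a = some (i, x, l) :=
  ⟨some ⟨(i, x, l), h1, h2⟩, rfl⟩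

/-- Multiplication of underlying triples. -/
def mulT (a b : Option (I × A × Λ)) : Option (I × A × Λ) :=
  a.bind fun a => b.bind fun b => (R.P a.2.2 b.1).map fun p =>
    (a.1, S.mul (S.mul a.2.1 p) b.2.1, b.2.2)

theorem mul0_some (i x l j y m) (hx : Valid S R.F R.G (i, x, l)) (hy : Valid S R.F R.G (j, y, m)) :
    val R (mul0 S R (some ⟨(i, x, l), hx⟩) (some ⟨(j, y, m), hy⟩)) =
      (R.P l j).map fun p => (i, S.mul (S.mul x p) y, m) := by
  change val R (match hp : R.P l j with
    | some p => (some ⟨(i, S.mul (S.mul x p) y, m),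
        prod_valid S hx hy (R.P_src l j p hp) (R.P_tgt l j p hp)⟩ : Carrier0 S R)
    | none => (none : Carrier0 S R)) = _
  split
  · rename_i hp
    exact (congrArg (Option.map fun p => (i, S.mul (S.mul x p) y, m)) hp).symm
  · rename_i hp
    exact (congrArg (Option.map fun p => (i, S.mul (S.mul x p) y, m)) hp).symm

theorem val_mul (a b : Carrier0 S R) : val R (mul0 S R a b) = mulT R (val R a) (val R b) := by
  rcases a with _ | ⟨⟨i, x, l⟩, hx⟩
  · rcases b with _ | ⟨⟨j, y, m⟩, hy⟩ <;> rfl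
  · rcases b with _ | ⟨⟨j, y, m⟩, hy⟩
    · rfl
    · exact mul0_some R i x l j y m hx hy

theorem mulT_some {a b : Option (I × A × Λ)} {i x l} (h : mulT R a b = some (i, x, l)) :
    ∃ x' l' j y p, a = some (i, x', l') ∧ b = some (j, y, l) ∧ R.P l' j = some p ∧
      x = S.mul (S.mul x' p) y := by
  rcases a with _ | ⟨i', x', l'⟩
  · simp [mulT] at h
  rcases b with _ | ⟨j, y, m⟩
  · simp [mulT] at h
  simp only [mulT, Option.bind_some, Option.map_eq_some_iff, Prod.mk.injEq] at h
  obtain ⟨p, hp, rfl, rfl, rfl⟩ := h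
  exact ⟨_, _, _, _, _, rfl, rfl, hp, rfl⟩

theorem mul0_assoc (a b c : Carrier0 S R) :
    mul0 S R (mul0 S R a b) c = mul0 S R a (mul0 S R b c) := by
  apply val_inj
  simp only [val_mul]
  rcases ha : val R a with _ | ⟨i, x, l⟩
  · simp [mulT]
  rcases hb : val R b with _ | ⟨j, y, m⟩
  · simp [mulT]
  rcases hc : val R c with _ | ⟨k, z, n⟩
  · simp [mulT]
  have va := val_valid R ha
  have vb := val_valid R hb
  have vc := val_valid R hc
  rcases hp : R.P l j with _ | p
  · rcases hq : R.P m k with _ | q <;> simp [mulT, hp, hq]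
  rcases hq : R.P m k with _ | q
  · simp [mulT, hp, hq]
  have p1 := R.P_src _ _ _ hp
  have p2 := R.P_tgt _ _ _ hp
  have q1 := R.P_src _ _ _ hq
  have q2 := R.P_tgt _ _ _ hq
  simp only [mulT, hp, hq, Option.bind_some, Option.map_some, Option.some.injEq, Prod.mk.injEq,
    true_and, and_true]
  have e1 : S.tgt x = S.src p := by rw [p1, va.2]
  have e2 : S.tgt p = S.src y := by rw [p2, vb.1]
  have e3 : S.tgt y = S.src q := by rw [q1, vb.2]
  have e4 : S.tgt q = S.src z := by rw [q2, vc.1]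
  rw [S.mul_assoc' (S.mul x p) y q ((S.tgt_mul _ _ e1).trans e2) e3,
    S.mul_assoc' (S.mul x p) (S.mul y q) z]
  · rw [S.tgt_mul _ _ e1, S.src_mul _ _ e3, e2]
  · rw [S.tgt_mul _ _ e3, e4]

end Rees

section Main

open Rees

variable {O A I Λ E : Type} {S : Sgpd O A} (R : Rees.Data0 S I Λ)
  (C : ChoiceOfReps (Rees.pre0 S R) E)

/-- Evaluation in the Rees matrix semigroup, as an underlying triple. -/
def rho (u : List E) : Option (Option (I × A × Λ)) :=
  (evalPath? (Rees.pre0 S R) C.lab u).map (val R)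

theorem rho_eq_iff {u v : List E} : rho R C u = rho R C v ↔
    evalPath? (Rees.pre0 S R) C.lab u = evalPath? (Rees.pre0 S R) C.lab v :=
  ⟨fun h => Option.map_injective (fun _ _ h => val_inj R h) h, fun h => by rw [rho, h, rho]⟩

theorem rho_valid {u : List E} {i x l} (h : rho R C u = some (some (i, x, l))) :
    R.F i = S.src x ∧ S.tgt x = R.G l := by
  obtain ⟨m, -, hm⟩ := Option.map_eq_some_iff.1 h
  exact val_valid R hm

theorem map_mulO (o : Option (Carrier0 S R)) (m : Carrier0 S R) :
    (mulO (pre0 S R) o m).map (val R) =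
      some ((o.map (val R)).elim (val R m) (fun a => mulT R a (val R m))) := by
  cases o <;> simp [mulO, pre0, val_mul]

theorem rho_snoc (u : List E) (e : E) : rho R C (u ++ [e]) =
    some ((rho R C u).elim (val R (C.lab e)) (fun a => mulT R a (val R (C.lab e)))) := by
  rw [rho, evalPath_snoc, map_mulO]; rfl

/-- Labels of the new edges. -/
def nlab (a0 : A) (f : Option E × E) : A :=
  (val R (C.lab f.2)).elim a0 fun t => f.1.elim t.2.1 fun g =>
    (val R (C.lab g)).elim a0 fun s => (R.P s.2.2 t.1).elim a0 fun p => S.mul p t.2.1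

theorem enc_eval (a0 : A) (u : List E) (i : I) (x : A) (l : Λ)
    (h : rho R C u = some (some (i, x, l))) :
    evalPath? S.toPreSgpd (nlab R C a0) (enc u) = some x ∧
    IsPathChain (fun e => S.src (nlab R C a0 e)) (fun e => S.tgt (nlab R C a0 e)) (enc u) ∧
    pathTgt? (fun e => S.tgt (nlab R C a0 e)) (enc u) = some (R.G l) ∧
    (∃ f j y, u.getLast? = some f ∧ val R (C.lab f) = some (j, y, l)) ∧
    (∃ f y m, u.head? = some f ∧ val R (C.lab f) = some (i, y, m)) := by
  induction u using List.reverseRecOn generalizing x l with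
  | nil => simp [rho, evalPath?] at h
  | append_singleton u e ih =>
    rw [enc_append_singleton, evalPath_snoc]
    rw [rho_snoc] at h
    cases hu : rho R C u with
    | none =>
      have hu0 : u = [] := by cases u <;> simp_all [rho, evalPath?]
      subst hu0
      rw [hu] at h
      simp only [Option.elim, Option.some.injEq] at h
      have v := val_valid R h
      refine ⟨by simp [enc, encFrom, evalPath?, mulO, nlab, h], ?_, ?_, ?_, ?_⟩
      · exact List.isChain_singleton _
      · simp [pathTgt?, enc, encFrom, nlab, h, v.2]
      · exact ⟨e, i, x, by simp, h⟩
      · exact ⟨e, x, l, by simp, h⟩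
    | some a =>
      rw [hu] at h
      simp only [Option.elim, Option.some.injEq] at h
      obtain ⟨x', l', j, y, p, rfl, hb, hp, rfl⟩ := mulT_some R h
      obtain ⟨h1, h2, h3, ⟨f, j', y', hf, hf'⟩, ⟨f', y'', m, hf'', hf'''⟩⟩ := ih _ _ hu
      have hl : nlab R C a0 (u.getLast?, e) = S.mul p y := by
        simp [nlab, hb, hf, hf', hp]
      have v := rho_valid R C hu
      have vb := val_valid R hb
      have p1 := R.P_src _ _ _ hp
      have p2 := R.P_tgt _ _ _ hp
      have e1 : S.tgt x' = S.src p := by rw [p1, v.2]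
      have e2 : S.tgt p = S.src y := by rw [p2, vb.1]
      refine ⟨?_, ?_, ?_, ?_, ?_⟩
      · rw [h1, hl]
        simp [mulO, S.mul_assoc' _ _ _ e1 e2]
      · refine List.isChain_append.2 ⟨h2, by simp, ?_⟩
        intro z hz w hw
        simp at hw
        subst hw
        show S.tgt (nlab R C a0 z) = S.src (nlab R C a0 (u.getLast?, e))
        rw [hl, S.src_mul _ _ e2, p1]
        rw [Option.mem_def] at hz
        simpa [pathTgt?, hz] using h3
      · simp only [pathTgt?, List.getLast?_append, List.getLast?_singleton, Option.some_or,
          Option.map_some, hl, S.tgt_mul _ _ e2, vb.2]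
      · exact ⟨e, j, y, by simp, hb⟩
      · exact ⟨f', y'', m, by simp [hf''], hf'''⟩

theorem finite_I {S : Sgpd O A} (R : Rees.Data0 S I Λ) (C : ChoiceOfReps (Rees.pre0 S R) E)
    [Finite E] : Finite I := by
  have : ∀ i : I, ∃ e : E, ∃ y m, val R (C.lab e) = some (i, y, m) := by
    intro i
    obtain ⟨a, ha⟩ := R.F_into i
    obtain ⟨l, hl⟩ := R.G_onto a
    obtain ⟨m, hm⟩ := exists_val R ha.symm hl.symm
    obtain ⟨w, hw, hw'⟩ := C.K_onto m
    obtain ⟨-, -, -, -, f, y, m, -, h⟩ := enc_eval R C a w i a l (by simp [rho, hw', hm])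
    exact ⟨f, y, m, h⟩
  choose f y m h using this
  refine Finite.of_injective f fun i j hij => ?_
  have h1 := h i
  rw [hij, h j] at h1
  simp at h1
  exact h1.1.symm

theorem finite_L {S : Sgpd O A} (R : Rees.Data0 S I Λ) (C : ChoiceOfReps (Rees.pre0 S R) E)
    [Finite E] : Finite Λ := by
  have : ∀ l : Λ, ∃ e : E, ∃ i y, val R (C.lab e) = some (i, y, l) := by
    intro l
    obtain ⟨a, ha⟩ := R.G_into l
    obtain ⟨i, hi⟩ := R.F_onto a
    obtain ⟨m, hm⟩ := exists_val R hi ha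
    obtain ⟨w, hw, hw'⟩ := C.K_onto m
    obtain ⟨-, -, -, ⟨f, j, y, -, h⟩, -⟩ := enc_eval R C a w i a l (by simp [rho, hw', hm])
    exact ⟨f, j, y, h⟩
  choose f y m h using this
  refine Finite.of_injective f fun i j hij => ?_
  have h1 := h i
  rw [hij, h j] at h1
  simp at h1
  exact h1.2.2.symm

theorem shape_regular [Finite E] (Q : I → Λ → Prop) :
    IsRegularSet {u : List E | ∃ i x l, rho R C u = some (some (i, x, l)) ∧ Q i l} := by
  classical
  have := finite_I R C
  have := finite_L R C
  let sh : Option (I × A × Λ) → Option (I × Λ) := fun t => t.map fun t => (t.1, t.2.2)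
  let sm : Option (I × Λ) → Option (I × Λ) → Option (I × Λ) := fun a b =>
    a.bind fun a => b.bind fun b => if (R.P a.2 b.1).isSome then some (a.1, b.2) else none
  have hsm : ∀ a b, sh (mulT R a b) = sm (sh a) (sh b) := by
    rintro (_ | ⟨i, x, l⟩) (_ | ⟨j, y, m⟩)
    · rfl
    · rfl
    · rfl
    · rcases hp : R.P l j with _ | p <;> simp [sh, sm, mulT, hp]
  let st : Option (Option (I × Λ)) → E → Option (Option (I × Λ)) := fun s e =>
    some (s.elim (sh (val R (C.lab e))) (fun a => sm a (sh (val R (C.lab e)))))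
  have hst : ∀ u : List E, u.foldl st none = (rho R C u).map sh := by
    intro u
    induction u using List.reverseRecOn with
    | nil => rfl
    | append_singleton u e ih =>
      rw [List.foldl_append, ih, rho_snoc]
      cases rho R C u <;> simp [st, hsm]
  refine rg_iff.2 ⟨_, inferInstance, st, none,
    {s | ∃ i l, s = some (some (i, l)) ∧ Q i l}, fun u => ?_⟩
  simp only [Set.mem_ofPred_eq, hst]
  constructor
  · rintro ⟨i, x, l, h, hQ⟩
    exact ⟨i, l, by simp [h, sh], hQ⟩
  · rintro ⟨i, l, h, hQ⟩
    rcases hr : rho R C u with _ | _ | ⟨i', x, l'⟩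
    · simp [hr] at h
    · simp [hr, sh] at h
    · simp [hr, sh] at h
      obtain ⟨rfl, rfl⟩ := h
      exact ⟨_, x, _, rfl, hQ⟩

/-- Right multiplication by the value of a word. -/
theorem rec_mul (hC : IsAutomaticStructure C) (w : List E) :
    Rec2 (fun u v => u ∈ C.K ∧ v ∈ C.K ∧
      evalPath? (pre0 S R) C.lab (u ++ w) = evalPath? (pre0 S R) C.lab v) := by
  have hne : ∀ u ∈ C.K, u ≠ [] := fun u hu => (C.K_path u hu).1
  induction w with
  | nil =>
    refine (rec2_of_syncRegular ?_ (hC.2.2.2 ())).congr ?_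
    · rintro r ⟨h1, h2, -⟩; exact ⟨hne _ h1, hne _ h2⟩
    · intro u v
      simp only [relVertex, List.append_nil, Set.mem_ofPred_eq]
      refine and_congr_right fun hu => and_congr_right fun hv => ?_
      simp [pathTgt?, List.getLast?_eq_some_getLast (hne u hu)]
  | cons e w ih =>
    have h1 := rec2_of_syncRegular (by 
      rintro r ⟨h1, h2, -⟩; exact ⟨hne _ h1, hne _ h2⟩) (hC.2.2.1 e)
    refine (h1.comp ih).congr ?_
    intro u v
    constructor
    · rintro ⟨hu, hv, h⟩
      obtain ⟨a, ha⟩ := evalPath_some (pre0 S R) C.lab (l := u ++ [e]) (by simp)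
      obtain ⟨z, hz, hz'⟩ := C.K_onto a
      refine ⟨z, ⟨hu, hz, ?_, ha.trans hz'.symm⟩, hz, hv, ?_⟩
      · simp [pathTgt?, List.getLast?_eq_some_getLast (hne u hu)]
      · rw [← h, List.append_cons u e w]
        exact evalPath_append_congr _ _ (hz'.trans ha.symm) w
    · rintro ⟨z, ⟨hu, hz, -, h⟩, -, hv, h'⟩
      refine ⟨hu, hv, ?_⟩
      rw [List.append_cons u e w, ← h']
      exact evalPath_append_congr _ _ h w

/-- Replacing the last letter `g` of `u` by the element `m g`. -/
def Zrel (m : E → Carrier0 S R) (u v : List E) : Prop :=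
  ∃ g u', u = u' ++ [g] ∧ u ∈ prefs C.K ∧ v ∈ C.K ∧
    evalPath? (pre0 S R) C.lab v = mulO (pre0 S R) (evalPath? (pre0 S R) C.lab u') (m g)

theorem rec_Z (hC : IsPrefixAutomaticStructure C) (m : E → Carrier0 S R) :
    Rec2 (Zrel R C m) := by
  have := hC.1.1
  have hne : ∀ u ∈ C.K, u ≠ [] := fun u hu => (C.K_path u hu).1
  refine Rec2.exists_fin fun g => ?_
  obtain ⟨w, hw, hw'⟩ := C.K_onto (m g)
  have hA : Rec2 (fun u v => u = [g] ∧ ∃ z, z = w ∧ (z ∈ C.K ∧ v ∈ C.K ∧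
      evalPath? (pre0 S R) C.lab (z ++ []) = evalPath? (pre0 S R) C.lab v)) :=
    (Rec2.right_eq [g]).symm.and ((Rec2.right_eq w).comp (rec_mul R C hC.1 []))
  have hP : Rec2 (fun u v => (u, v) ∈ relPrefEq C) :=
    rec2_of_syncRegular (by rintro r ⟨h1, h2, -⟩; exact ⟨hne _ h1, h2.1⟩) hC.2
  have hB := (Rec2.snoc g).symm.comp (hP.symm.comp (rec_mul R C hC.1 w))
  have hK := Rec2.left (prefs_regular hC.1.2.1)
  refine (hK.and (hA.or hB)).congr fun u v => ?_
  constructor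
  · rintro ⟨u', rfl, hu, hv, h⟩
    refine ⟨hu, ?_⟩
    by_cases hn : u' = []
    · subst hn
      refine Or.inl ⟨rfl, w, rfl, hw, hv, ?_⟩
      rw [List.append_nil, hw', h]; rfl
    · obtain ⟨a, ha⟩ := evalPath_some (pre0 S R) C.lab hn
      obtain ⟨z, hz, hz'⟩ := C.K_onto a
      have hu' : u' ∈ prefs C.K := by
        obtain ⟨-, l, hl, hp⟩ := hu
        exact ⟨hn, l, hl, (List.prefix_append _ _).trans hp⟩
      refine Or.inr ⟨u', rfl, z, ⟨hz, hu', hz'.trans ha.symm⟩, hz, hv, ?_⟩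
      rw [h, evalPath_append _ _ (mul0_assoc R) _ _ _ hw', ha, hz']
  · rintro ⟨hu, ⟨rfl, _, rfl, -, hv, h⟩ | ⟨u', rfl, z, ⟨hz, hu', h1⟩, -, hv, h⟩⟩
    · refine ⟨[], rfl, hu, hv, ?_⟩
      rw [← h, List.append_nil, hw']; rfl
    · refine ⟨u', rfl, hu, hv, ?_⟩
      dsimp only at h1
      rw [← h, evalPath_append _ _ (mul0_assoc R) _ _ _ hw', h1]

theorem step_sem {u : List E} {g : E} {i x l}
    (h : rho R C (u ++ [g]) = some (some (i, x, l))) :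
    ∃ j y, val R (C.lab g) = some (j, y, l) ∧ S.tgt y = S.tgt x ∧
      (∀ m mu, val R m = some (j, y, mu) →
        (mulO (pre0 S R) (evalPath? (pre0 S R) C.lab u) m).map (val R) =
          some (some (i, x, mu))) ∧
      (∀ m b mu, S.tgt x = S.src b → val R m = some (j, S.mul y b, mu) →
        (mulO (pre0 S R) (evalPath? (pre0 S R) C.lab u) m).map (val R) =
          some (some (i, S.mul x b, mu))) := by
  have hv := rho_valid R C h
  rw [rho_snoc] at h
  simp only [map_mulO]
  change ∃ j y, _ ∧ _ ∧ (∀ m mu, _ → some ((rho R C u).elim _ _) = _) ∧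
    (∀ m b mu, _ → _ → some ((rho R C u).elim _ _) = _)
  cases hu : rho R C u with
  | none =>
    rw [hu] at h
    simp only [Option.elim, Option.some.injEq] at h
    refine ⟨i, x, h, rfl, ?_, ?_⟩
    · intro m mu hm; simp [hm]
    · intro m b mu _ hm; simp [hm]
  | some a =>
    rw [hu] at h
    simp only [Option.elim, Option.some.injEq] at h
    obtain ⟨x', l', j, y, p, rfl, hb, hp, rfl⟩ := mulT_some R h
    have v := rho_valid R C hu
    have vb := val_valid R hb
    have p1 := R.P_src _ _ _ hp
    have p2 := R.P_tgt _ _ _ hp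
    have e1 : S.tgt x' = S.src p := by rw [p1, v.2]
    have e2 : S.tgt (S.mul x' p) = S.src y := by rw [S.tgt_mul _ _ e1, p2, vb.1]
    refine ⟨j, y, hb, (S.tgt_mul _ _ e2).symm, ?_, ?_⟩
    · intro m mu hm; simp [hm, mulT, hp]
    · intro m b mu hxb hm
      rw [S.tgt_mul _ _ e2] at hxb
      simp [hm, mulT, hp, S.mul_assoc' _ _ _ e2 hxb]


variable (ci : O → I) (cl : O → Λ)

/-- Representatives of triples with canonical indices. -/
def K0 : Set (List E) :=
  C.K ∩ {u | ∃ i x l, rho R C u = some (some (i, x, l)) ∧ (i = ci (R.F i) ∧ l = cl (R.G l))}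

theorem K0_spec {u : List E} (h : u ∈ K0 R C ci cl) : u ∈ C.K ∧
    ∃ x, rho R C u = some (some (ci (S.src x), x, cl (S.tgt x))) := by
  obtain ⟨hK, i, x, l, h, hi, hl⟩ := h
  have v := rho_valid R C h
  refine ⟨hK, x, ?_⟩
  rw [← v.1, v.2, ← hi, ← hl, h]

theorem K0_mk {u : List E} {x : A} (hK : u ∈ C.K)
    (h : rho R C u = some (some (ci (S.src x), x, cl (S.tgt x)))) : u ∈ K0 R C ci cl := by
  have v := rho_valid R C h
  exact ⟨hK, _, x, _, h, by rw [v.1], by rw [← v.2]⟩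

theorem K0_regular (hC : IsAutomaticStructure C) : IsRegularSet (K0 R C ci cl) := by
  have := hC.1
  exact rg_inter hC.2.1 (shape_regular R C fun i l => i = ci (R.F i) ∧ l = cl (R.G l))

theorem rho_prefix (u w : List E) (hu : u ≠ []) {i x l}
    (h : rho R C (u ++ w) = some (some (i, x, l))) :
    ∃ y m, rho R C u = some (some (i, y, m)) := by
  induction w using List.reverseRecOn generalizing x l with
  | nil => exact ⟨x, l, by simpa using h⟩
  | append_singleton w e ih =>
    rw [← List.append_assoc, rho_snoc] at h
    cases hr : rho R C (u ++ w) with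
    | none =>
      obtain ⟨a, ha⟩ := evalPath_some (pre0 S R) C.lab (l := u ++ w) (by simp [hu])
      simp [rho, ha] at hr
    | some a =>
      rw [hr] at h
      simp only [Option.elim, Option.some.injEq] at h
      obtain ⟨x', l', j, y, p, rfl, -⟩ := mulT_some R h
      exact ih hr

theorem prefs_K0 {v : List E} (h : v ∈ prefs (K0 R C ci cl)) : v ∈ prefs C.K ∧
    ∃ y m, rho R C v = some (some (ci (S.src y), y, m)) := by
  obtain ⟨hne, l, hl, t, rfl⟩ := h
  obtain ⟨hK, x, hx⟩ := K0_spec R C ci cl hl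
  obtain ⟨y, m, hy⟩ := rho_prefix R C v t hne hx
  refine ⟨⟨hne, _, hK, List.prefix_append _ _⟩, y, m, ?_⟩
  rw [← (rho_valid R C hy).1, (rho_valid R C hx).1, hy]

/-- The new choice of representatives. -/
def newC (a0 : A) (hci : ∀ a, R.F (ci (S.src a)) = S.src a)
    (hcl : ∀ a, R.G (cl (S.tgt a)) = S.tgt a) :
    ChoiceOfReps S.toPreSgpd (Option E × E) where
  esrc e := S.src (nlab R C a0 e)
  etgt e := S.tgt (nlab R C a0 e)
  lab := nlab R C a0
  lab_src _ := rfl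
  lab_tgt _ := rfl
  K := {y | ∃ x ∈ K0 R C ci cl, enc x = y}
  K_path := by
    rintro _ ⟨u, hu, rfl⟩
    obtain ⟨hK, x, hx⟩ := K0_spec R C ci cl hu
    exact ⟨fun h => (C.K_path u hK).1 (enc_eq_nil.1 h), (enc_eval R C a0 u _ _ _ hx).2.1⟩
  K_onto := by
    intro a
    obtain ⟨m, hm⟩ := exists_val R (hci a) (hcl a).symm
    obtain ⟨w, hw, hw'⟩ := C.K_onto m
    have hr : rho R C w = some (some (ci (S.src a), a, cl (S.tgt a))) := by simp [rho, hw', hm]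
    exact ⟨enc w, ⟨w, K0_mk R C ci cl hw hr, rfl⟩, (enc_eval R C a0 w _ _ _ hr).1⟩

theorem sync_of' [Finite E] {V : Type} {etgt : Option E × E → V}
    {T : Set (List (Option E × E) × List (Option E × E))} {Q : List E → List E → Prop}
    (hQ : Rec2 Q) (h : ∀ p, p ∈ T ↔ ∃ u v, Q u v ∧ p = (enc u, enc v)) :
    SyncRegular etgt T := by
  have := syncRegular_of_rec2 etgt hQ
  convert this using 1
  ext p
  exact h p

theorem newC_vertex (hC : IsPrefixAutomaticStructure C) (a0 : A)
    (hci : ∀ a, R.F (ci (S.src a)) = S.src a)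
    (hcl : ∀ a, R.G (cl (S.tgt a)) = S.tgt a) (v : O) :
    SyncRegular (newC R C ci cl a0 hci hcl).etgt (relVertex (newC R C ci cl a0 hci hcl) v) := by
  have := hC.1.1
  have hK := K0_regular R C ci cl hC.1
  refine sync_of' ((Rec2.left hK).and ((Rec2.right hK).and
    ((Rec2.left (shape_regular R C fun _ l => R.G l = v)).and (rec_mul R C hC.1 [])))) ?_
  rintro ⟨p, q⟩
  constructor
  · rintro ⟨⟨u, hu, rfl⟩, ⟨w, hw, rfl⟩, h1, h2⟩
    refine ⟨u, w, ⟨hu, hw, ?_⟩, rfl⟩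
    obtain ⟨hu', x, hx⟩ := K0_spec R C ci cl hu
    obtain ⟨hw', y, hy⟩ := K0_spec R C ci cl hw
    have ex := enc_eval R C a0 u _ _ _ hx
    have ey := enc_eval R C a0 w _ _ _ hy
    have hxy : some x = some y := ex.1.symm.trans (h2.trans ey.1)
    have hv : some (R.G (cl (S.tgt x))) = some v := ex.2.2.1.symm.trans h1
    cases hxy
    refine ⟨⟨_, _, _, hx, by simpa using hv⟩, hu', hw', ?_⟩
    rw [List.append_nil, ← rho_eq_iff, hx, hy]
  · rintro ⟨u, w, ⟨hu, hw, ⟨i, x, l, hx, hl⟩, hu', hw', h⟩, hpq⟩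
    cases hpq
    rw [List.append_nil, ← rho_eq_iff] at h
    have ex := enc_eval R C a0 u _ _ _ hx
    have ey := enc_eval R C a0 w _ _ _ (h.symm.trans hx)
    refine ⟨⟨u, hu, rfl⟩, ⟨w, hw, rfl⟩, ?_, ?_⟩
    · exact ex.2.2.1.trans (by rw [hl])
    · exact ex.1.trans ey.1.symm

theorem newC_edge (hC : IsPrefixAutomaticStructure C) (a0 : A)
    (hci : ∀ a, R.F (ci (S.src a)) = S.src a)
    (hcl : ∀ a, R.G (cl (S.tgt a)) = S.tgt a) (e : Option E × E) :
    SyncRegular (newC R C ci cl a0 hci hcl).etgt (relEdge (newC R C ci cl a0 hci hcl) e) := by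
  have := hC.1.1
  have hK := K0_regular R C ci cl hC.1
  obtain ⟨b, hb⟩ : ∃ b, b = nlab R C a0 e := ⟨_, rfl⟩
  have hm : ∀ g : E, ∃ m : Carrier0 S R, ∀ j y l, val R (C.lab g) = some (j, y, l) →
      S.tgt y = S.src b → val R m = some (j, S.mul y b, cl (S.tgt b)) := by
    intro g
    by_cases h : ∃ j y l, val R (C.lab g) = some (j, y, l) ∧ S.tgt y = S.src b
    · obtain ⟨j, y, l, h1, h2⟩ := h
      obtain ⟨m, hm⟩ := exists_val R (i := j) (x := S.mul y b) (l := cl (S.tgt b))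
        (by rw [S.src_mul _ _ h2, (val_valid R h1).1]) (by rw [S.tgt_mul _ _ h2, hcl])
      refine ⟨m, fun j' y' l' h3 _ => ?_⟩
      rw [h1] at h3
      cases h3
      exact hm
    · exact ⟨none, fun j y l h1 h2 => absurd ⟨j, y, l, h1, h2⟩ h⟩
  choose m hm using hm
  refine sync_of' ((Rec2.left hK).and ((Rec2.right hK).and
    ((Rec2.left (shape_regular R C fun _ l => R.G l = S.src b)).and (rec_Z R C hC m)))) ?_
  -- the value reached by the relation `Zrel`
  have key : ∀ (u' : List E) (g : E) i x l, rho R C (u' ++ [g]) = some (some (i, x, l)) →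
      R.G l = S.src b → (mulO (pre0 S R) (evalPath? (pre0 S R) C.lab u') (m g)).map (val R) =
        some (some (i, S.mul x b, cl (S.tgt b))) := by
    intro u' g i x l hx hl
    obtain ⟨j, y, h1, h2, -, h3⟩ := step_sem R C hx
    have hxb : S.tgt x = S.src b := by rw [(rho_valid R C hx).2, hl]
    exact h3 _ _ _ hxb (hm g j y l h1 (h2.trans hxb))
  have hsn : ∀ u : List E, evalPath? S.toPreSgpd (nlab R C a0) (enc u ++ [e]) =
      mulO S.toPreSgpd (evalPath? S.toPreSgpd (nlab R C a0) (enc u)) b := by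
    intro u; rw [evalPath_snoc, hb]
  rintro ⟨p, q⟩
  constructor
  · rintro ⟨⟨u, hu, rfl⟩, ⟨w, hw, rfl⟩, h1, h2⟩
    refine ⟨u, w, ⟨hu, hw, ?_⟩, rfl⟩
    obtain ⟨hu', x, hx⟩ := K0_spec R C ci cl hu
    obtain ⟨hw', y, hy⟩ := K0_spec R C ci cl hw
    have ex := enc_eval R C a0 u _ _ _ hx
    have ey := enc_eval R C a0 w _ _ _ hy
    have hv : some (R.G (cl (S.tgt x))) = some (S.src b) := by
      rw [hb]; exact ex.2.2.1.symm.trans h1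
    have hv' : R.G (cl (S.tgt x)) = S.src b := by simpa using hv
    have hxb : S.tgt x = S.src b := by rw [(rho_valid R C hx).2, hv']
    have hxy : some (S.mul x b) = some y := by
      have := (hsn u).symm.trans (h2.trans ey.1)
      rw [ex.1] at this
      exact this
    cases hxy
    refine ⟨⟨_, _, _, hx, hv'⟩, ?_⟩
    rcases List.eq_nil_or_concat u with rfl | ⟨u', g, rfl⟩
    · exact absurd rfl (C.K_path _ hu').1
    rw [List.concat_eq_append] at *
    refine ⟨g, u', rfl, ⟨by simp, _, hu', List.prefix_refl _⟩, hw', ?_⟩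
    apply Option.map_injective (fun _ _ h => val_inj R h)
    rw [key _ _ _ _ _ hx hv']
    have : rho R C w = _ := hy
    rw [S.src_mul _ _ hxb, S.tgt_mul _ _ hxb] at this
    exact this
  · rintro ⟨u, w, ⟨hu, hw, ⟨i, x, l, hx, hl⟩, g, u', rfl, -, hw', h⟩, hpq⟩
    cases hpq
    have hr : rho R C w = some (some (i, S.mul x b, cl (S.tgt b))) := by
      rw [rho, h]; exact key _ _ _ _ _ hx hl
    have ex := enc_eval R C a0 _ _ _ _ hx
    have ey := enc_eval R C a0 w _ _ _ hr
    refine ⟨⟨_, hu, rfl⟩, ⟨w, hw, rfl⟩, ?_, ?_⟩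
    · refine ex.2.2.1.trans ?_
      rw [hl, hb]; rfl
    · refine (hsn _).trans (Eq.trans ?_ ey.1.symm)
      rw [ex.1]; rfl

theorem newC_pref (hC : IsPrefixAutomaticStructure C) (a0 : A)
    (hci : ∀ a, R.F (ci (S.src a)) = S.src a)
    (hcl : ∀ a, R.G (cl (S.tgt a)) = S.tgt a) :
    SyncRegular (newC R C ci cl a0 hci hcl).etgt (relPrefEq (newC R C ci cl a0 hci hcl)) := by
  have := hC.1.1
  have hK := K0_regular R C ci cl hC.1
  have hm : ∀ g : E, ∃ m : Carrier0 S R, ∀ j y l, val R (C.lab g) = some (j, y, l) →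
      val R m = some (j, y, cl (S.tgt y)) := by
    intro g
    by_cases h : ∃ j y l, val R (C.lab g) = some (j, y, l)
    · obtain ⟨j, y, l, h1⟩ := h
      obtain ⟨m, hm⟩ := exists_val R (i := j) (x := y) (l := cl (S.tgt y))
        (val_valid R h1).1 (hcl y).symm
      refine ⟨m, fun j' y' l' h3 => ?_⟩
      rw [h1] at h3
      cases h3
      exact hm
    · exact ⟨none, fun j y l h1 => absurd ⟨j, y, l, h1⟩ h⟩
  choose m hm using hm
  have key : ∀ (u' : List E) (g : E) i x l, rho R C (u' ++ [g]) = some (some (i, x, l)) →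
      (mulO (pre0 S R) (evalPath? (pre0 S R) C.lab u') (m g)).map (val R) =
        some (some (i, x, cl (S.tgt x))) := by
    intro u' g i x l hx
    obtain ⟨j, y, h1, h2, h3, -⟩ := step_sem R C hx
    refine h3 _ _ ?_
    rw [hm g j y l h1, h2]
  refine sync_of' ((Rec2.left hK).and ((Rec2.right (prefs_regular hK)).and
    (rec_Z R C hC m).symm)) ?_
  rintro ⟨p, q⟩
  constructor
  · rintro ⟨⟨u, hu, rfl⟩, hq, h2⟩
    obtain ⟨w, hw, rfl⟩ := (enc_prefs _ _).1 hq
    refine ⟨u, w, ⟨hu, hw, ?_⟩, rfl⟩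
    obtain ⟨hu', x, hx⟩ := K0_spec R C ci cl hu
    obtain ⟨hw', y, l, hy⟩ := prefs_K0 R C ci cl hw
    have ex := enc_eval R C a0 u _ _ _ hx
    have ey := enc_eval R C a0 w _ _ _ hy
    have hxy : some x = some y := ex.1.symm.trans (h2.trans ey.1)
    cases hxy
    rcases List.eq_nil_or_concat w with rfl | ⟨w', g, rfl⟩
    · exact absurd rfl hw'.1
    rw [List.concat_eq_append] at *
    refine ⟨g, w', rfl, hw', hu', ?_⟩
    apply Option.map_injective (fun _ _ h => val_inj R h)
    rw [key _ _ _ _ _ hy]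
    exact hx
  · rintro ⟨u, w, ⟨hu, hw, g, w', rfl, -, hu', h⟩, hpq⟩
    cases hpq
    obtain ⟨-, y, l, hy⟩ := prefs_K0 R C ci cl hw
    have hr : rho R C u = some (some (ci (S.src y), y, cl (S.tgt y))) := by
      rw [rho, h]; exact key _ _ _ _ _ hy
    have ex := enc_eval R C a0 u _ _ _ hr
    have ey := enc_eval R C a0 _ _ _ _ hy
    exact ⟨⟨u, hu, rfl⟩, (enc_prefs _ _).2 ⟨_, hw, rfl⟩, ex.1.trans ey.1.symm⟩

end Main

/-- Theorem 5.3: if a Rees matrix semigroup with zero is prefix-automatic then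
the underlying semigroupoid is prefix-automatic. -/
theorem stmt_14 {O A I Λ : Type} (S : Sgpd O A) (hne : Nonempty A)
    (hiso : IsolationFree S.toPreSgpd)
    (R : Rees.Data0 S I Λ)
    (hM : IsPrefixAutomatic (Rees.pre0 S R)) :
    IsPrefixAutomatic S.toPreSgpd := by
  classical
  obtain ⟨E, C, hC⟩ := hM
  obtain ⟨a0⟩ := hne
  have hI : ∀ o : O, ∃ i : I, (∃ a, S.src a = o) → R.F i = o := by
    intro o
    by_cases h : ∃ a, S.src a = o
    · obtain ⟨a, rfl⟩ := h
      obtain ⟨i, hi⟩ := R.F_onto a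
      exact ⟨i, fun _ => hi⟩
    · obtain ⟨i, -⟩ := R.F_onto a0
      exact ⟨i, fun h' => absurd h' h⟩
  have hL : ∀ o : O, ∃ l : Λ, (∃ a, S.tgt a = o) → R.G l = o := by
    intro o
    by_cases h : ∃ a, S.tgt a = o
    · obtain ⟨a, rfl⟩ := h
      obtain ⟨i, hi⟩ := R.G_onto a
      exact ⟨i, fun _ => hi⟩
    · obtain ⟨i, -⟩ := R.G_onto a0
      exact ⟨i, fun h' => absurd h' h⟩
  choose ci hci using hI
  choose cl hcl using hL
  have hci' : ∀ a, R.F (ci (S.src a)) = S.src a := fun a => hci _ ⟨a, rfl⟩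
  have hcl' : ∀ a, R.G (cl (S.tgt a)) = S.tgt a := fun a => hcl _ ⟨a, rfl⟩
  have hfin := hC.1.1
  exact ⟨Option E × E, newC R C ci cl a0 hci' hcl',
    ⟨inferInstance, enc_regular (K0_regular R C ci cl hC.1),
      newC_edge R C ci cl hC a0 hci' hcl', newC_vertex R C ci cl hC a0 hci' hcl'⟩,
    newC_pref R C ci cl hC a0 hci' hcl'⟩

end AutoRees
end
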